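/- arXiv:math/0305327 — 4 statements merged into one kernel-verified Lean document; each statement's English description precedes it below -/
import Mathlib

section
/- For all n and k, e(2n+2, 2k+2) − o(2n+2, 2k+2) = b(n,k)², where b(n,k) = ((2k−n+1)/(n+1))·C(n+1,k+1) is the ballot number. -/
open scoped Classical
open Polynomial

/-- A permutation of `{1,…,n}` (modeled on `Fin n`) is 321-avoiding if there are no
indices `i < j < k` with `π i > π j > π k`. -/
def Avoids321 {n : ℕ} (π : Equiv.Perm (Fin n)) : Prop :=
  ¬ ∃ i j k : Fin n, i < j ∧ j < k ∧ π k < π j ∧ π j < π i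

/-- The length of the longest increasing subsequence of a permutation. -/
noncomputable def lis {n : ℕ} (π : Equiv.Perm (Fin n)) : ℕ :=
  sSup {k : ℕ | ∃ s : Finset (Fin n),
    (∀ i ∈ s, ∀ j ∈ s, i < j → π i < π j) ∧ s.card = k}

/-- The ballot number `b(n,k) = ((2k−n+1)/(n+1))·C(n+1,k+1)`. -/
def ballotNum (n k : ℕ) : ℕ := ((2 * k + 1 - n) * Nat.choose (n + 1) (k + 1)) / (n + 1)

/-- `eCount n k` is the number of even 321-avoiding permutations of `{1,…,n}`
whose longest increasing subsequence has length `k`. -/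
noncomputable def eCount (n k : ℕ) : ℕ :=
  Nat.card {π : Equiv.Perm (Fin n) // Avoids321 π ∧ lis π = k ∧ Equiv.Perm.sign π = 1}

/-- `oCount n k` is the number of odd 321-avoiding permutations of `{1,…,n}`
whose longest increasing subsequence has length `k`. -/
noncomputable def oCount (n k : ℕ) : ℕ :=
  Nat.card {π : Equiv.Perm (Fin n) // Avoids321 π ∧ lis π = k ∧ Equiv.Perm.sign π = -1}

/-- `RowInsert l A B`: scanning `l` from right to left by (reversed) row insertion never bumps an
entry out of the second row and ends in the tableau with rows `A` and `B`. -/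
inductive RowInsert {α : Type*} [LinearOrder α] : List α → Finset α → Finset α → Prop
  | nil : RowInsert [] ∅ ∅
  | add {l : List α} {A B : Finset α} (x : α) (h : RowInsert l A B) (hA : ∀ a ∈ A, x < a)
      (hB : x ∉ B) : RowInsert (x :: l) (insert x A) B
  | bump {l : List α} {A B : Finset α} (x y : α) (h : RowInsert l A B) (hy : y ∈ A) (hyx : y < x)
      (hA : ∀ a ∈ A, a ≤ y ∨ x < a) (hyB : ∀ b ∈ B, y < b) (hB : x ∉ B) :
      RowInsert (x :: l) (insert x (A.erase y)) (insert y B)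

/-- Every final segment contains at least as many elements of `A` as of `B`. -/
def Ballot {α : Type*} [LinearOrder α] (A B : Finset α) : Prop :=
  ∀ v, (B.filter (v ≤ ·)).card ≤ (A.filter (v ≤ ·)).card

/-- The sign contributed by the letter `x` standing to the left of `z`. -/
def invSign {α : Type*} [LinearOrder α] (x z : α) : ℤ := if z < x then -1 else 1

/-- The sign of a word: `-1` to the number of inversions. -/
def wordSign {α : Type*} [LinearOrder α] : List α → ℤ
  | [] => 1
  | x :: l => (l.map (invSign x)).prod * wordSign l

/-- The sign of the two-row tableau with rows `A` and `B`. -/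
def tableauSign {α : Type*} [LinearOrder α] (A B : Finset α) : ℤ :=
  ∏ a ∈ A, ∏ b ∈ B, invSign a b

/-- The sign-imbalance of the two-row shape `(a, b)`. -/
def signImbalance : ℕ → ℕ → ℤ
  | 0, 0 => 1
  | 0, _ + 1 => 0
  | a + 1, 0 => signImbalance a 0
  | a + 1, b + 1 =>
    if b ≤ a then signImbalance a (b + 1) + (-1) ^ (a + 1) * signImbalance (a + 1) b else 0

section RowInsert

variable {α : Type*} [LinearOrder α]

theorem RowInsert.disjoint_and_nodup {l : List α} {A B : Finset α} (h : RowInsert l A B) :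
    Disjoint A B ∧ l.Nodup ∧ l.toFinset = A ∪ B := by
  simp only [Finset.disjoint_left]
  induction h with
  | nil => simp
  | @add l A B x h hA hB ih =>
    obtain ⟨h1, h2, h3⟩ := ih
    have hx : ∀ z, z ∈ l ↔ z ∈ A ∪ B := fun z => by rw [← List.mem_toFinset, h3]
    refine ⟨by grind, by grind, ?_⟩
    rw [List.toFinset_cons, h3, Finset.insert_union]
  | @bump l A B x y h hy hyx hA hyB hB ih =>
    obtain ⟨h1, h2, h3⟩ := ih
    have hx : ∀ z, z ∈ l ↔ z ∈ A ∪ B := fun z => by rw [← List.mem_toFinset, h3]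
    refine ⟨by grind, by grind, ?_⟩
    rw [List.toFinset_cons, h3]
    grind

theorem RowInsert.unique {l : List α} {A B A' B' : Finset α} (h : RowInsert l A B)
    (h' : RowInsert l A' B') : A = A' ∧ B = B' := by
  induction h generalizing A' B' with
  | nil => cases h'; simp
  | add x h hA hB ih =>
    cases h' with
    | add _ h' hA' hB' => obtain ⟨rfl, rfl⟩ := ih h'; simp
    | bump _ y h' hy hyx hA' hyB hB' => obtain ⟨rfl, rfl⟩ := ih h'; grind
  | bump x y h hy hyx hA hyB hB ih =>
    cases h' with
    | add _ h' hA' hB' => obtain ⟨rfl, rfl⟩ := ih h'; grind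
    | bump _ y' h' hy' hyx' hA' hyB' hB' =>
      obtain ⟨rfl, rfl⟩ := ih h'
      have : y = y' := by
        rcases hA _ hy' with h1 | h1 <;> rcases hA' _ hy with h2 | h2 <;> order
      subst this; simp

theorem card_filter_le_insert_of_lt {A : Finset α} {x : α} (hA : ∀ a ∈ A, x < a) (v : α) :
    ((insert x A).filter (v ≤ ·)).card =
      if v ≤ x then A.card + 1 else (A.filter (v ≤ ·)).card := by
  rw [Finset.filter_insert]
  split_ifs with hv
  · rw [Finset.card_insert_of_notMem (by grind), Finset.filter_true_of_mem]
    intro a ha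
    exact hv.trans (hA a ha).le
  · rfl

theorem card_filter_le_bump {A : Finset α} {x y : α} (hy : y ∈ A) (hyx : y < x)
    (hA : ∀ a ∈ A, a ≤ y ∨ x < a) (v : α) :
    ((insert x (A.erase y)).filter (v ≤ ·)).card =
      if y < v ∧ v ≤ x then (A.filter (x ≤ ·)).card + 1 else (A.filter (v ≤ ·)).card := by
  split_ifs with hv
  · have : (insert x (A.erase y)).filter (v ≤ ·) = insert x (A.filter (x ≤ ·)) := by
      ext z
      simp only [Finset.mem_filter, Finset.mem_insert, Finset.mem_erase]
      constructor
      · rintro ⟨rfl | ⟨h1, h2⟩, h3⟩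
        · simp
        · rcases hA z h2 with h | h
          · exact absurd (h3.trans h) (not_le.2 hv.1)
          · exact Or.inr ⟨h2, h.le⟩
      · rintro (rfl | ⟨h1, h2⟩)
        · exact ⟨Or.inl rfl, hv.2⟩
        · exact ⟨Or.inr ⟨(hyx.trans_le h2).ne', h1⟩, hv.2.trans h2⟩
    rw [this, Finset.card_insert_of_notMem]
    grind
  · by_cases hvy : v ≤ y
    · have : (insert x (A.erase y)).filter (v ≤ ·) = insert x ((A.filter (v ≤ ·)).erase y) := by
        grind
      rw [this, Finset.card_insert_of_notMem, Finset.card_erase_add_one]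
      · grind
      · grind
    · congr 1
      grind

theorem RowInsert.ballot {l : List α} {A B : Finset α} (h : RowInsert l A B) : Ballot A B := by
  induction h with
  | nil => intro v; simp
  | add x h hA hB ih =>
    intro v
    exact (ih v).trans
      (Finset.card_le_card (Finset.filter_subset_filter _ (Finset.subset_insert _ _)))
  | @bump l A B x y h hy hyx hA hyB hB ih =>
    intro v
    rw [card_filter_le_bump hy hyx hA, card_filter_le_insert_of_lt hyB]
    have hlt : ∀ v w, v ≤ y → y < w → (A.filter (w ≤ ·)).card < (A.filter (v ≤ ·)).card := by
      intro v w hv hw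
      apply Finset.card_lt_card
      rw [Finset.ssubset_iff_of_subset]
      · exact ⟨y, by simp [hy, hv, hw]⟩
      · intro z
        simp only [Finset.mem_filter]
        exact fun h => ⟨h.1, (hv.trans hw.le).trans h.2⟩
    by_cases hvy : v ≤ y
    · rw [if_pos hvy, if_neg (by simp [hvy])]
      rcases B.eq_empty_or_nonempty with rfl | hne
      · exact Nat.succ_le_of_lt (Nat.zero_lt_of_lt (hlt v x hvy hyx))
      · have h1 := hlt v (B.min' hne) hvy (hyB _ (B.min'_mem hne))
        have h2 := ih (B.min' hne)
        rw [Finset.filter_true_of_mem fun b hb => B.min'_le b hb] at h2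
        omega
    · rw [if_neg hvy]
      split_ifs with hv
      · have : A.filter (v ≤ ·) = A.filter (x ≤ ·) := by grind
        have := ih v
        simp_all
        omega
      · exact ih v

/-- The word `l` contains an inversion whose larger entry is less than `v`. -/
def HasInversionBelow (l : List α) (v : α) : Prop :=
  ∃ a b, [a, b].Sublist l ∧ b < a ∧ a < v

/-- The word `l` has no decreasing subsequence of length three. -/
def ListAvoids321 (l : List α) : Prop :=
  ¬ ∃ a b c, [a, b, c].Sublist l ∧ c < b ∧ b < a

theorem hasInversionBelow_cons {x v : α} {l : List α} :
    HasInversionBelow (x :: l) v ↔ HasInversionBelow l v ∨ (x < v ∧ ∃ z ∈ l, z < x) := by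
  constructor
  · rintro ⟨a, b, hs, hba, hav⟩
    rcases List.sublist_cons_iff.1 hs with h | ⟨r, h, hr⟩
    · exact Or.inl ⟨a, b, h, hba, hav⟩
    · obtain ⟨rfl, rfl⟩ := List.cons.inj h
      exact Or.inr ⟨hav, b, List.singleton_sublist.1 hr, hba⟩
  · rintro (⟨a, b, hs, hba, hav⟩ | ⟨hxv, z, hz, hzx⟩)
    · exact ⟨a, b, hs.cons _, hba, hav⟩
    · exact ⟨x, z, (List.singleton_sublist.2 hz).cons_cons _, hzx, hxv⟩

theorem listAvoids321_cons {x : α} {l : List α} :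
    ListAvoids321 (x :: l) ↔ ListAvoids321 l ∧ ¬ HasInversionBelow l x := by
  simp only [ListAvoids321, ← not_or]
  refine not_congr ⟨?_, ?_⟩
  · rintro ⟨a, b, c, hs, hcb, hba⟩
    rcases List.sublist_cons_iff.1 hs with h | ⟨r, h, hr⟩
    · exact Or.inl ⟨a, b, c, h, hcb, hba⟩
    · obtain ⟨rfl, rfl⟩ := List.cons.inj h
      exact Or.inr ⟨b, c, hr, hcb, hba⟩
  · rintro (⟨a, b, c, hs, hcb, hba⟩ | ⟨b, c, hr, hcb, hba⟩)
    · exact ⟨a, b, c, hs.cons _, hcb, hba⟩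
    · exact ⟨x, b, c, hr.cons_cons _, hcb, hba⟩

theorem RowInsert.hasInversionBelow_iff {l : List α} {A B : Finset α} (h : RowInsert l A B)
    (v : α) : HasInversionBelow l v ↔ ∃ y ∈ A, ∃ z ∈ B, z < y ∧ y < v := by
  induction h with
  | nil => simp [HasInversionBelow]
  | @add l A B x h hA hB ih =>
    have hx : ∀ z, z ∈ l ↔ z ∈ A ∪ B := fun z => by
      rw [← List.mem_toFinset, h.disjoint_and_nodup.2.2]
    rw [hasInversionBelow_cons, ih]
    grind
  | @bump l A B x y h hy hyx hA hyB hB ih =>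
    have hx : ∀ z, z ∈ l ↔ z ∈ A ∪ B := fun z => by
      rw [← List.mem_toFinset, h.disjoint_and_nodup.2.2]
    rw [hasInversionBelow_cons, ih]
    constructor
    · rintro (⟨y0, hy0, z, hz, hzy, hyv⟩ | ⟨hxv, -⟩)
      · have := hyB z hz
        refine ⟨y0, ?_, z, by simp [hz], hzy, hyv⟩
        grind
      · exact ⟨x, by simp, y, by simp, hyx, hxv⟩
    · rintro ⟨y0, hy0, z, hz, hzy, hyv⟩
      by_cases hxv : x < v
      · exact Or.inr ⟨hxv, y, by simp [hx, hy], hyx⟩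
      · left
        have h1 : y0 ∈ A ∧ y0 ≠ y := by grind
        have h2 : z ≠ y := by grind
        exact ⟨y0, h1.1, z, by grind, hzy, hyv⟩

theorem RowInsert.listAvoids321 {l : List α} {A B : Finset α} (h : RowInsert l A B) :
    ListAvoids321 l := by
  induction h with
  | nil => simp [ListAvoids321]
  | @add l A B x h hA hB ih =>
    rw [listAvoids321_cons, h.hasInversionBelow_iff]
    exact ⟨ih, by grind⟩
  | @bump l A B x y h hy hyx hA hyB hB ih =>
    rw [listAvoids321_cons, h.hasInversionBelow_iff]
    exact ⟨ih, by grind⟩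

theorem exists_rowInsert {l : List α} (hn : l.Nodup) (h : ListAvoids321 l) :
    ∃ A B, RowInsert l A B := by
  induction l with
  | nil => exact ⟨∅, ∅, .nil⟩
  | cons x l ih =>
    rw [listAvoids321_cons] at h
    rw [List.nodup_cons] at hn
    obtain ⟨A, B, hl⟩ := ih hn.2 h.1
    have hx : x ∉ A ∪ B := by
      rw [← hl.disjoint_and_nodup.2.2, List.mem_toFinset]; exact hn.1
    have hd := Finset.disjoint_left.1 hl.disjoint_and_nodup.1
    rw [hl.hasInversionBelow_iff] at h
    by_cases hA : ∀ a ∈ A, x < a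
    · exact ⟨_, _, hl.add x hA (by grind)⟩
    · have hne : (A.filter (· < x)).Nonempty := by
        push Not at hA
        obtain ⟨a, ha, hax⟩ := hA
        exact ⟨a, by grind⟩
      obtain ⟨y, hy, hmax⟩ := (A.filter (· < x)).exists_max_image id hne
      simp only [Finset.mem_filter, id] at hy hmax
      refine ⟨_, _, hl.bump x y hy.1 hy.2 ?_ ?_ (by grind)⟩
      · grind
      · grind

theorem RowInsert.longest {l : List α} {A B : Finset α} (h : RowInsert l A B) (v : α) :
    (∃ s : List α, s.Sublist l ∧ s.Pairwise (· < ·) ∧ (∀ a ∈ s, v ≤ a) ∧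
      s.length = (A.filter (v ≤ ·)).card) ∧
    ∀ s : List α, s.Sublist l → s.Pairwise (· < ·) → (∀ a ∈ s, v ≤ a) →
      s.length ≤ (A.filter (v ≤ ·)).card := by
  have key : ∀ (x : α) (l : List α) (A A' : Finset α), x ∉ l →
      (∀ v, (A'.filter (v ≤ ·)).card = (A.filter (v ≤ ·)).card ∨
        (v ≤ x ∧ (A'.filter (v ≤ ·)).card = (A.filter (x ≤ ·)).card + 1)) →
      (∀ v, (A.filter (v ≤ ·)).card ≤ (A'.filter (v ≤ ·)).card) →
      (∀ v, v ≤ x → (A.filter (x ≤ ·)).card + 1 ≤ (A'.filter (v ≤ ·)).card) →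
      (∀ v, (∃ s : List α, s.Sublist l ∧ s.Pairwise (· < ·) ∧ (∀ a ∈ s, v ≤ a) ∧
        s.length = (A.filter (v ≤ ·)).card) ∧
        ∀ s : List α, s.Sublist l → s.Pairwise (· < ·) → (∀ a ∈ s, v ≤ a) →
        s.length ≤ (A.filter (v ≤ ·)).card) →
      ∀ v, (∃ s : List α, s.Sublist (x :: l) ∧ s.Pairwise (· < ·) ∧ (∀ a ∈ s, v ≤ a) ∧
        s.length = (A'.filter (v ≤ ·)).card) ∧
        ∀ s : List α, s.Sublist (x :: l) → s.Pairwise (· < ·) → (∀ a ∈ s, v ≤ a) →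
        s.length ≤ (A'.filter (v ≤ ·)).card := by
    intro x l A A' hxl hdich hmono hstep ih v
    constructor
    · rcases hdich v with h | ⟨hvx, h⟩
      · obtain ⟨s, h1, h2, h3, h4⟩ := (ih v).1
        exact ⟨s, h1.cons _, h2, h3, h4.trans h.symm⟩
      · obtain ⟨s, h1, h2, h3, h4⟩ := (ih x).1
        refine ⟨x :: s, h1.cons_cons _, ?_, ?_, ?_⟩
        · refine List.pairwise_cons.2 ⟨fun a ha => lt_of_le_of_ne (h3 a ha) ?_, h2⟩
          rintro rfl
          exact hxl (h1.subset ha)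
        · intro a ha
          rcases List.mem_cons.1 ha with rfl | ha
          · exact hvx
          · exact hvx.trans (h3 a ha)
        · rw [List.length_cons, h4, h]
    · intro s hs hp hv
      rcases List.sublist_cons_iff.1 hs with h | ⟨r, rfl, hr⟩
      · exact ((ih v).2 s h hp hv).trans (hmono v)
      · rw [List.pairwise_cons] at hp
        have h1 := (ih x).2 r hr hp.2 fun a ha => (hp.1 a ha).le
        have h2 := hstep v (hv x (by simp))
        simp only [List.length_cons]
        omega
  induction h generalizing v with
  | nil => simp
  | @add l A B x h hA hB ih =>
    have hn := (h.add x hA hB).disjoint_and_nodup.2.1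
    have hf : A.filter (x ≤ ·) = A := Finset.filter_true_of_mem fun a ha => (hA a ha).le
    refine key x l A _ (List.nodup_cons.1 hn).1 ?_ ?_ ?_ (fun v => ih v) v
    all_goals
      intro v
      have := Finset.card_filter_le A (v ≤ ·)
      rw [card_filter_le_insert_of_lt hA]
      grind
  | @bump l A B x y h hy hyx hA hyB hB ih =>
    have hn := (h.bump x y hy hyx hA hyB hB).disjoint_and_nodup.2.1
    have hmono : ∀ v w, v ≤ w → (A.filter (w ≤ ·)).card ≤ (A.filter (v ≤ ·)).card := by
      intro v w hvw
      apply Finset.card_le_card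
      intro z
      simp only [Finset.mem_filter]
      exact fun h => ⟨h.1, hvw.trans h.2⟩
    have hlt : ∀ v, v ≤ y → (A.filter (x ≤ ·)).card < (A.filter (v ≤ ·)).card := by
      intro v hv
      apply Finset.card_lt_card
      rw [Finset.ssubset_iff_of_subset]
      · exact ⟨y, by simp [hy, hyx, hv]⟩
      · intro z
        simp only [Finset.mem_filter]
        exact fun h => ⟨h.1, (hv.trans hyx.le).trans h.2⟩
    have heq : ∀ v, y < v → v ≤ x → A.filter (v ≤ ·) = A.filter (x ≤ ·) := by
      intro v h1 h2
      ext z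
      simp only [Finset.mem_filter]
      refine and_congr_right fun hz => ⟨fun h => ?_, fun h => h2.trans h⟩
      rcases hA z hz with h' | h'
      · exact absurd (h.trans h') (not_le.2 h1)
      · exact h'.le
    refine key x l A _ (List.nodup_cons.1 hn).1 ?_ ?_ ?_ (fun v => ih v) v
    · intro v
      rw [card_filter_le_bump hy hyx hA]
      split_ifs with hv
      · exact Or.inr ⟨hv.2, rfl⟩
      · exact Or.inl rfl
    · intro v
      rw [card_filter_le_bump hy hyx hA]
      split_ifs with hv
      · rw [heq v hv.1 hv.2]; omega
      · rfl
    · intro v hvx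
      rw [card_filter_le_bump hy hyx hA]
      split_ifs with hv
      · rfl
      · exact hlt v (not_lt.1 fun h => hv ⟨h, hvx⟩)

theorem prod_map_invSign {l : List α} {A B : Finset α} (h : RowInsert l A B) (x : α) :
    (l.map (invSign x)).prod = (∏ a ∈ A, invSign x a) * ∏ b ∈ B, invSign x b := by
  obtain ⟨h1, h2, h3⟩ := h.disjoint_and_nodup
  rw [← Finset.prod_union h1, ← h3, List.prod_toFinset _ h2]

theorem invSign_of_lt {x z : α} (h : x < z) : invSign x z = 1 := if_neg h.not_gt

theorem invSign_of_gt {x z : α} (h : z < x) : invSign x z = -1 := if_pos h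

theorem tableauSign_add {A B : Finset α} {x : α} (hA : ∀ a ∈ A, x < a) :
    (∏ a ∈ A, invSign x a) * (∏ b ∈ B, invSign x b) * tableauSign A B =
      tableauSign (insert x A) B := by
  unfold tableauSign
  rw [Finset.prod_insert (fun h => lt_irrefl _ (hA x h)),
    Finset.prod_eq_one fun a ha => invSign_of_lt (hA a ha), one_mul]

theorem tableauSign_bump {A B : Finset α} {x y : α} (hy : y ∈ A) (hyx : y < x)
    (hA : ∀ a ∈ A, a ≤ y ∨ x < a) (hyB : ∀ b ∈ B, y < b) :
    (∏ a ∈ A, invSign x a) * (∏ b ∈ B, invSign x b) * tableauSign A B =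
      (-1) ^ (A.card - 1) * tableauSign (insert x (A.erase y)) (insert y B) := by
  have hyB' : y ∉ B := fun h => lt_irrefl _ (hyB y h)
  have hx : x ∉ A.erase y := by grind
  unfold tableauSign
  rw [Finset.prod_insert hx, Finset.prod_insert hyB']
  simp_rw [Finset.prod_insert hyB']
  rw [Finset.prod_mul_distrib, ← Finset.mul_prod_erase A _ hy, ← Finset.mul_prod_erase A _ hy,
    Finset.prod_eq_one (s := B) (f := invSign y) fun b hb => invSign_of_lt (hyB b hb)]
  have h1 : ∏ a ∈ A.erase y, invSign x a =
      (-1) ^ (A.card - 1) * ∏ a ∈ A.erase y, invSign a y := by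
    rw [← Finset.card_erase_of_mem hy, ← Finset.prod_const, ← Finset.prod_mul_distrib]
    refine Finset.prod_congr rfl fun a ha => ?_
    obtain ⟨hay, haA⟩ := Finset.mem_erase.1 ha
    rcases hA a haA with h | h
    · rw [invSign_of_gt (h.trans_lt hyx), invSign_of_lt (lt_of_le_of_ne h hay)]; rfl
    · rw [invSign_of_lt h, invSign_of_gt (hyx.trans h)]; rfl
  rw [h1]
  ring

/-- The words whose insertion tableau has rows `A` and `B`. -/
noncomputable def tableauWords (A B : Finset α) : Finset (List α) :=
  (A ∪ B).val.lists.toFinset.filter (RowInsert · A B)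

theorem mem_tableauWords {A B : Finset α} {l : List α} :
    l ∈ tableauWords A B ↔ RowInsert l A B := by
  rw [tableauWords, Finset.mem_filter, Multiset.mem_toFinset, Multiset.mem_lists_iff]
  refine and_iff_right_of_imp fun h => ?_
  obtain ⟨-, h2, h3⟩ := h.disjoint_and_nodup
  rw [← h3, List.toFinset_val, h2.dedup]; rfl

theorem Ballot.nonempty_left {A B : Finset α} (h : Ballot A B) (hB : B.Nonempty) :
    A.Nonempty := by
  obtain ⟨b, hb⟩ := hB
  by_contra hA
  rw [Finset.not_nonempty_iff_eq_empty] at hA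
  subst hA
  have := h b
  simp only [Finset.filter_empty, Finset.card_empty, Nat.le_zero, Finset.card_eq_zero,
    Finset.filter_eq_empty_iff] at this
  exact this hb le_rfl

theorem Ballot.card_le {A B : Finset α} (h : Ballot A B) : B.card ≤ A.card := by
  rcases B.eq_empty_or_nonempty with rfl | hB
  · simp
  · have := h (B.min' hB)
    rw [Finset.filter_true_of_mem fun b hb => B.min'_le b hb] at this
    exact this.trans (Finset.card_filter_le _ _)

theorem tableauWords_of_empty_right {A : Finset α} (hA : A.Nonempty) :
    tableauWords A ∅ = (tableauWords (A.erase (A.min' hA)) ∅).image (A.min' hA :: ·) := by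
  ext l
  simp only [Finset.mem_image, mem_tableauWords]
  constructor
  · intro h
    generalize hB : (∅ : Finset α) = B at h
    cases h with
    | nil => simp at hA
    | @add l A B x h hA' hB' =>
      subst hB
      have hm : (insert x A).min' hA = x := by
        apply le_antisymm (Finset.min'_le _ _ (by simp))
        refine Finset.le_min' _ _ _ fun z hz => ?_
        grind
      refine ⟨l, ?_, by rw [hm]⟩
      rwa [hm, Finset.erase_insert (by grind)]
    | bump => exact absurd hB.symm (Finset.insert_ne_empty _ _)
  · rintro ⟨l, h, rfl⟩
    have := h.add (A.min' hA) (fun a ha => A.min'_lt_of_mem_erase_min' hA ha) (by simp)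
    rwa [Finset.insert_erase (A.min'_mem hA)] at this

theorem tableauWords_of_next {A B : Finset α} (hd : Disjoint A B) (hA : A.Nonempty) {x y : α}
    (hyB : y ∈ B) (hB : ∀ b ∈ B, y ≤ b) (hxA : x ∈ A) (hyx : y < x)
    (hx : ∀ a ∈ A, y < a → x ≤ a) :
    tableauWords A B = (tableauWords (A.erase (A.min' hA)) B).image (A.min' hA :: ·) ∪
      (tableauWords (insert y (A.erase x)) (B.erase y)).image (x :: ·) := by
  rw [Finset.disjoint_left] at hd
  ext l
  simp only [Finset.mem_image, Finset.mem_union, mem_tableauWords]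
  constructor
  · intro h
    cases h with
    | nil => simp at hA
    | @add l A B x' h hA' hB' =>
      left
      have hm : (insert x' A).min' hA = x' := by
        apply le_antisymm (Finset.min'_le _ _ (by simp))
        refine Finset.le_min' _ _ _ fun z hz => ?_
        grind
      refine ⟨l, ?_, by rw [hm]⟩
      rwa [hm, Finset.erase_insert (by grind)]
    | @bump l A B x' y' h hy hyx' hA' hyB' hB' =>
      right
      have hy' : y' = y := by
        apply le_antisymm
        · rcases Finset.mem_insert.1 hyB with rfl | h
          · rfl
          · exact (hyB' _ h).le
        · exact hB _ (by simp)
      subst hy'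
      have hxx : x' = x := by
        apply le_antisymm
        · have := hA' x
          grind
        · exact hx x' (by simp) hyx'
      subst hxx
      refine ⟨l, ?_, rfl⟩
      rw [Finset.erase_insert (by grind), Finset.erase_insert (by grind),
        Finset.insert_erase hy]
      exact h
  · rintro (⟨l, h, rfl⟩ | ⟨l, h, rfl⟩)
    · have := h.add (A.min' hA) (fun a ha => A.min'_lt_of_mem_erase_min' hA ha)
        (hd (A.min'_mem hA))
      rwa [Finset.insert_erase (A.min'_mem hA)] at this
    · have := h.bump x y (by simp) hyx (by grind) (by grind) (by grind)
      rwa [Finset.insert_erase hyB, Finset.erase_insert (by grind),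
        Finset.insert_erase hxA] at this

theorem ballot_reverse_bump {A B : Finset α} (h : Ballot A B) {x y : α}
    (hyA : y ∉ A) (hyB : y ∈ B) (hB : ∀ b ∈ B, y ≤ b) (hxA : x ∈ A) (hyx : y < x)
    (hx : ∀ a ∈ A, y < a → x ≤ a) : Ballot (insert y (A.erase x)) (B.erase y) := by
  intro v
  by_cases hvx : v ≤ x
  · have hle := h y
    rw [Finset.filter_true_of_mem hB] at hle
    have h1 : ((B.erase y).filter (v ≤ ·)).card ≤ B.card - 1 := by
      rw [← Finset.card_erase_of_mem hyB]; exact Finset.card_filter_le _ _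
    have h2 : (A.filter (y ≤ ·)).card - 1 ≤ ((insert y (A.erase x)).filter (v ≤ ·)).card := by
      rw [← Finset.card_erase_of_mem (by simp [hxA, hyx.le] : x ∈ A.filter (y ≤ ·))]
      apply Finset.card_le_card
      intro z
      simp only [Finset.mem_filter, Finset.mem_insert, Finset.mem_erase]
      rintro ⟨h1, h2, h3⟩
      refine ⟨Or.inr ⟨h1, h2⟩, hvx.trans (hx z h2 (lt_of_le_of_ne h3 ?_))⟩
      rintro rfl
      exact hyA h2
    omega
  · have h1 : (B.erase y).filter (v ≤ ·) ⊆ B.filter (v ≤ ·) :=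
      Finset.filter_subset_filter _ (Finset.erase_subset _ _)
    have h2 : A.filter (v ≤ ·) ⊆ (insert y (A.erase x)).filter (v ≤ ·) := by grind
    exact (Finset.card_le_card h1).trans ((h v).trans (Finset.card_le_card h2))

theorem sum_wordSign_image_cons (A B : Finset α) (x : α) :
    ∑ l ∈ (tableauWords A B).image (x :: ·), wordSign l =
      (∏ a ∈ A, invSign x a) * (∏ b ∈ B, invSign x b) * ∑ l ∈ tableauWords A B, wordSign l := by
  rw [Finset.sum_image (fun _ _ _ _ h => (List.cons.inj h).2), Finset.mul_sum]
  refine Finset.sum_congr rfl fun l hl => ?_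
  rw [wordSign, prod_map_invSign (mem_tableauWords.1 hl)]

theorem signImbalance_eq_zero {a b : ℕ} (h : a < b) : signImbalance a b = 0 := by
  match a, b with
  | 0, 0 => simp at h
  | 0, _ + 1 => rw [signImbalance]
  | a + 1, 0 => simp at h
  | a + 1, b + 1 => rw [signImbalance, if_neg (by omega)]

theorem sum_wordSign_tableauWords {A B : Finset α} (hd : Disjoint A B) :
    ∑ l ∈ tableauWords A B, wordSign l =
      if Ballot A B then tableauSign A B * ((-1) ^ B.card * signImbalance A.card B.card) else 0 := by
  induction hn : A.card + B.card generalizing A B with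
  | zero =>
    obtain ⟨hA, hB⟩ := Nat.add_eq_zero_iff.1 hn
    rw [Finset.card_eq_zero] at hA hB
    subst hA hB
    have : tableauWords (∅ : Finset α) ∅ = {[]} := by
      ext l
      rw [mem_tableauWords, Finset.mem_singleton]
      constructor
      · intro h
        simpa using h.disjoint_and_nodup.2.2
      · rintro rfl; exact .nil
    rw [this]
    have hb : Ballot (∅ : Finset α) ∅ := fun v => le_rfl
    simp [hb, wordSign, tableauSign, signImbalance]
  | succ n ih =>
    split_ifs with hb
    · have hA : A.Nonempty := by
        rcases B.eq_empty_or_nonempty with rfl | hB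
        · rw [← Finset.card_pos]; simp at hn; omega
        · exact hb.nonempty_left hB
      have hm : ∀ a ∈ A.erase (A.min' hA), A.min' hA < a :=
        fun a ha => A.min'_lt_of_mem_erase_min' hA ha
      have hcard : (A.erase (A.min' hA)).card = A.card - 1 :=
        Finset.card_erase_of_mem (A.min'_mem hA)
      obtain ⟨k, hk⟩ : ∃ k, A.card = k + 1 := ⟨A.card - 1, by have := hA.card_pos; omega⟩
      have hAdd : (∏ a ∈ A.erase (A.min' hA), invSign (A.min' hA) a) *
          (∏ b ∈ B, invSign (A.min' hA) b) *
          ∑ l ∈ tableauWords (A.erase (A.min' hA)) B, wordSign l =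
          tableauSign A B * ((-1) ^ B.card * signImbalance k B.card) := by
        rw [ih (hd.mono_left (Finset.erase_subset _ _)) (by omega), hcard, hk,
          Nat.add_sub_cancel]
        have := tableauSign_add (B := B) hm
        rw [Finset.insert_erase (A.min'_mem hA)] at this
        split_ifs with hb'
        · rw [← this]; ring
        · rw [signImbalance_eq_zero]
          · ring
          · by_contra hlt
            refine hb' fun v => ?_
            by_cases hv : v ≤ A.min' hA
            · rw [Finset.filter_true_of_mem fun a ha => hv.trans (hm a ha).le, hcard]
              have := Finset.card_filter_le B (v ≤ ·)
              omega
            · refine (hb v).trans (Finset.card_le_card ?_)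
              intro z
              simp only [Finset.mem_filter, Finset.mem_erase]
              rintro ⟨hz, hvz⟩
              refine ⟨⟨?_, hz⟩, hvz⟩
              rintro rfl
              exact hv hvz
      rcases B.eq_empty_or_nonempty with rfl | hB
      · rw [tableauWords_of_empty_right hA, sum_wordSign_image_cons, hAdd, hk,
          Finset.card_empty, signImbalance]
      · have hyB := B.min'_mem hB
        have hBy : ∀ b ∈ B, B.min' hB ≤ b := fun b hb => B.min'_le b hb
        generalize B.min' hB = y at hyB hBy
        have hyA : y ∉ A := Finset.disjoint_right.1 hd hyB
        have hne : (A.filter (y < ·)).Nonempty := by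
          have := hb y
          rw [Finset.filter_true_of_mem hBy] at this
          obtain ⟨a, ha⟩ := Finset.card_pos.1 (hB.card_pos.trans_le this)
          rw [Finset.mem_filter] at ha
          refine ⟨a, Finset.mem_filter.2 ⟨ha.1, lt_of_le_of_ne ha.2 ?_⟩⟩
          rintro rfl
          exact hyA ha.1
        obtain ⟨x, hx, hxmin⟩ := (A.filter (y < ·)).exists_min_image id hne
        simp only [Finset.mem_filter, id, and_imp] at hx hxmin
        obtain ⟨hxA, hyx⟩ := hx
        have hd' : Disjoint (insert y (A.erase x)) (B.erase y) := by
          rw [Finset.disjoint_left] at hd ⊢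
          grind
        have hcA : (insert y (A.erase x)).card = A.card := by
          rw [Finset.card_insert_of_notMem (by grind), Finset.card_erase_add_one hxA]
        obtain ⟨j, hj⟩ : ∃ j, B.card = j + 1 := ⟨B.card - 1, by have := hB.card_pos; omega⟩
        have hcB : (B.erase y).card = j := by rw [Finset.card_erase_of_mem hyB]; omega
        have hbump := tableauSign_bump (A := insert y (A.erase x)) (B := B.erase y) (x := x)
          (y := y) (by simp) hyx (by grind) (by grind)
        rw [Finset.insert_erase hyB, Finset.erase_insert (by grind), Finset.insert_erase hxA,
          hcA, hk, Nat.add_sub_cancel] at hbump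
        rw [tableauWords_of_next hd hA hyB hBy hxA hyx hxmin, Finset.sum_union,
          sum_wordSign_image_cons, sum_wordSign_image_cons, hAdd, ih hd' (by omega),
          if_pos (ballot_reverse_bump hb hyA hyB hBy hxA hyx hxmin),
          ← mul_assoc (_ * _) (tableauSign _ _), hbump,
          hcA, hcB, hk, hj, signImbalance, if_pos (by have := hb.card_le; omega)]
        · ring
        · rw [Finset.disjoint_left]
          intro l h1 h2
          simp only [Finset.mem_image, mem_tableauWords] at h1 h2
          obtain ⟨l1, h1, rfl⟩ := h1
          obtain ⟨l2, h2, heq⟩ := h2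
          obtain ⟨-, rfl⟩ := List.cons.inj heq
          have := congrArg Finset.card (h1.unique h2).1
          omega
    · apply Finset.sum_eq_zero
      intro l hl
      exact absurd (mem_tableauWords.1 hl).ballot hb

theorem ballot_insert_right {A B : Finset α} {m : α} (hA : ∀ a ∈ A, m < a)
    (hB : ∀ b ∈ B, m < b) : Ballot A (insert m B) ↔ Ballot A B ∧ B.card + 1 ≤ A.card := by
  simp only [Ballot, card_filter_le_insert_of_lt hB]
  constructor
  · intro h
    have hm := h m
    rw [if_pos le_rfl] at hm
    have hc := hm.trans (Finset.card_filter_le _ _)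
    refine ⟨fun v => ?_, hc⟩
    by_cases hv : v ≤ m
    · rw [Finset.filter_true_of_mem fun a ha => hv.trans (hA a ha).le]
      exact (Finset.card_filter_le _ _).trans (by omega)
    · simpa [hv] using h v
  · rintro ⟨h, hc⟩ v
    split_ifs with hv
    · rwa [Finset.filter_true_of_mem fun a ha => hv.trans (hA a ha).le]
    · exact h v

theorem ballot_insert_left {A B : Finset α} {m : α} (hA : ∀ a ∈ A, m < a)
    (hB : ∀ b ∈ B, m < b) : Ballot (insert m A) B ↔ Ballot A B := by
  simp only [Ballot, card_filter_le_insert_of_lt hA]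
  have hle : ∀ v, ¬ v ≤ m → (B.filter (v ≤ ·)).card ≤ (if v ≤ m then A.card + 1 else
      (A.filter (v ≤ ·)).card) → (B.filter (v ≤ ·)).card ≤ (A.filter (v ≤ ·)).card :=
    fun v hv h => by simpa [hv] using h
  constructor
  · intro h
    have hc : B.card ≤ A.card := by
      rcases B.eq_empty_or_nonempty with rfl | hne
      · simp
      · have := hle (B.min' hne) (not_le.2 (hB _ (B.min'_mem hne))) (h _)
        rw [Finset.filter_true_of_mem fun b hb => B.min'_le b hb] at this
        exact this.trans (Finset.card_filter_le _ _)
    intro v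
    by_cases hv : v ≤ m
    · rw [Finset.filter_true_of_mem fun a ha => hv.trans (hA a ha).le]
      exact (Finset.card_filter_le _ _).trans hc
    · exact hle v hv (h v)
  · intro h v
    split_ifs with hv
    · exact (h v).trans ((Finset.card_filter_le _ _).trans (Nat.le_succ _))
    · exact h v

theorem tableauSign_insert_left {A B : Finset α} {m : α} (hm : m ∉ A) (hB : ∀ b ∈ B, m < b) :
    tableauSign (insert m A) B = tableauSign A B := by
  rw [tableauSign, Finset.prod_insert hm, Finset.prod_eq_one fun b hb => invSign_of_lt (hB b hb),
    one_mul, tableauSign]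

theorem tableauSign_insert_right {A B : Finset α} {m : α} (hA : ∀ a ∈ A, m < a) (hm : m ∉ B) :
    tableauSign A (insert m B) = (-1) ^ A.card * tableauSign A B := by
  simp only [tableauSign, Finset.prod_insert hm]
  rw [Finset.prod_mul_distrib, Finset.prod_congr rfl fun a ha => invSign_of_gt (hA a ha),
    Finset.prod_const]

theorem sum_tableauSign (S : Finset α) {a b : ℕ} (h : a + b = S.card) :
    ∑ A ∈ S.powersetCard a, (if Ballot A (S \ A) then tableauSign A (S \ A) else 0) =
      signImbalance a b := by
  induction S using Finset.induction_on_min generalizing a b with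
  | empty =>
    obtain ⟨rfl, rfl⟩ : a = 0 ∧ b = 0 := by simpa using h
    have hb : Ballot (∅ : Finset α) ∅ := fun v => le_rfl
    simp [Finset.filter_singleton, hb, tableauSign, signImbalance]
  | insert m S hm ih =>
    have hmS : m ∉ S := fun h => lt_irrefl _ (hm m h)
    rw [Finset.card_insert_of_notMem hmS] at h
    match a, b with
    | 0, b =>
      have hb : ¬ Ballot ∅ (insert m S) := fun hb => by
        simpa using hb.nonempty_left (Finset.insert_nonempty m S)
      rw [signImbalance_eq_zero (by omega)]
      simp [hb]
    | a + 1, b =>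
      rw [Finset.powersetCard_succ_insert hmS, Finset.sum_union, Finset.sum_image]
      · have h1 : ∀ A ∈ S.powersetCard a, (if Ballot (insert m A) (insert m S \ insert m A) then
            tableauSign (insert m A) (insert m S \ insert m A) else 0) =
            if Ballot A (S \ A) then tableauSign A (S \ A) else 0 := by
          intro A hA
          have hAS := (Finset.mem_powersetCard.1 hA).1
          have hB : ∀ z ∈ S \ A, m < z := fun z hz => hm z (Finset.mem_sdiff.1 hz).1
          have heq : insert m S \ insert m A = S \ A := by grind
          rw [heq, tableauSign_insert_left (fun h => hmS (hAS h)) hB]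
          simp only [ballot_insert_left (fun z hz => hm z (hAS hz)) hB]
        have h2 : ∀ A ∈ S.powersetCard (a + 1), (if Ballot A (insert m S \ A) then
            tableauSign A (insert m S \ A) else 0) =
            if b ≤ a + 1 then
              (-1) ^ (a + 1) * if Ballot A (S \ A) then tableauSign A (S \ A) else 0 else 0 := by
          intro A hA
          obtain ⟨hAS, hAc⟩ := Finset.mem_powersetCard.1 hA
          have hB : ∀ z ∈ S \ A, m < z := fun z hz => hm z (Finset.mem_sdiff.1 hz).1
          have hle := Finset.card_le_card hAS
          have heq : insert m S \ A = insert m (S \ A) := by grind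
          rw [heq, tableauSign_insert_right (fun z hz => hm z (hAS hz)) (by simp [hmS]), hAc]
          simp only [ballot_insert_right (fun z hz => hm z (hAS hz)) hB, hAc,
            Finset.card_sdiff_of_subset hAS]
          have : S.card - (a + 1) + 1 ≤ a + 1 ↔ b ≤ a + 1 := by omega
          simp only [this]
          split_ifs <;> simp_all
        rw [Finset.sum_congr rfl h1, Finset.sum_congr rfl h2, ih (by omega : a + b = S.card)]
        match b with
        | 0 =>
          rw [Finset.powersetCard_eq_empty.2 (by omega), signImbalance]
          simp
        | b + 1 =>
          rw [signImbalance]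
          split_ifs with hba hba' hba'
          · rw [← Finset.mul_sum, ih (by omega : a + 1 + b = S.card), add_comm]
          · omega
          · omega
          · rw [signImbalance_eq_zero (by omega)]; simp
      · intro A hA A' hA' heq
        have h1 := (Finset.mem_powersetCard.1 (Finset.mem_coe.1 hA)).1
        have h2 := (Finset.mem_powersetCard.1 (Finset.mem_coe.1 hA')).1
        rw [← Finset.erase_insert (fun h => hmS (h1 h)), heq,
          Finset.erase_insert (fun h => hmS (h2 h))]
      · rw [Finset.disjoint_left]
        intro A hA hA'
        obtain ⟨A', -, rfl⟩ := Finset.mem_image.1 hA'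
        exact hmS ((Finset.mem_powersetCard.1 hA).1 (Finset.mem_insert_self _ _))

end RowInsert

/-- The ballot number of the shape `(i, j)`, in subtractive form. -/
def shapeBallot : ℕ → ℕ → ℤ
  | _, 0 => 1
  | i, j + 1 => (i + j + 1).choose (j + 1) - (i + j + 1).choose j

theorem shapeBallot_succ_succ (i j : ℕ) :
    shapeBallot (i + 1) (j + 1) = shapeBallot i (j + 1) + shapeBallot (i + 1) j := by
  match j with
  | 0 => simp [shapeBallot]
  | j + 1 =>
    have h1 := Nat.choose_succ_succ (i + j + 2) (j + 1)
    have h2 := Nat.choose_succ_succ (i + j + 2) j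
    simp only [Nat.succ_eq_add_one] at h1 h2
    simp only [shapeBallot]
    rw [show i + 1 + (j + 1) + 1 = i + j + 2 + 1 by ring, show i + (j + 1) + 1 = i + j + 2 by ring,
      show i + 1 + j + 1 = i + j + 2 by ring, show j + 1 + 1 = j + 2 by ring] at *
    rw [h1, h2]
    push_cast
    ring

theorem shapeBallot_self_succ (i : ℕ) : shapeBallot i (i + 1) = 0 := by
  rw [shapeBallot, Nat.choose_symm_of_eq_add (by ring : i + i + 1 = (i + 1) + i), sub_self]

theorem signImbalance_zero_right (a : ℕ) : signImbalance a 0 = 1 := by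
  induction a with
  | zero => rw [signImbalance]
  | succ a ih => rw [signImbalance, ih]

theorem signImbalance_succ_succ {a b : ℕ} (h : b ≤ a) : signImbalance (a + 1) (b + 1) =
    signImbalance a (b + 1) + (-1) ^ (a + 1) * signImbalance (a + 1) b := by
  rw [signImbalance, if_pos h]

theorem neg_one_pow_two_mul_add_one (i : ℕ) : (-1 : ℤ) ^ (2 * i + 1) = -1 := by
  rw [pow_succ, pow_mul]; simp

theorem signImbalance_odd (i : ℕ)
    (h : ∀ j ≤ i, signImbalance (2 * i) (2 * j + 1) = 0 ∧
      (j < i → signImbalance (2 * i) (2 * j + 2) = shapeBallot i (j + 1) - shapeBallot i j)) :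
    ∀ j ≤ i + 1, signImbalance (2 * i + 1) (2 * j) = shapeBallot i j ∧
      signImbalance (2 * i + 1) (2 * j + 1) = -shapeBallot i j := by
  have hodd := neg_one_pow_two_mul_add_one i
  intro j
  induction j with
  | zero =>
    intro _
    have h0 : signImbalance (2 * i) (0 + 1) = 0 := (h 0 (by omega)).1
    rw [mul_zero, signImbalance_succ_succ (by omega), h0, hodd, signImbalance_zero_right]
    simp [shapeBallot]
  | succ j ih =>
    intro hj
    have h2 := (ih (by omega)).2
    rw [show 2 * (j + 1) = 2 * j + 1 + 1 by ring]
    rcases Nat.lt_or_ge j i with hij | hij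
    · have h4 : signImbalance (2 * i + 1) (2 * j + 1 + 1) = shapeBallot i (j + 1) := by
        rw [signImbalance_succ_succ (by omega), h2, hodd, (h j hij.le).2 hij]
        ring
      refine ⟨h4, ?_⟩
      have h5 := (h (j + 1) hij).1
      rw [show 2 * (j + 1) = 2 * j + 1 + 1 by ring] at h5
      rw [signImbalance_succ_succ (by omega), h4, h5, hodd]
      ring
    · obtain rfl : i = j := by omega
      rw [signImbalance_eq_zero (by omega), signImbalance_eq_zero (by omega),
        shapeBallot_self_succ]
      simp

theorem signImbalance_even_of_odd (i : ℕ)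
    (h1 : ∀ j ≤ i + 1, signImbalance (2 * i + 1) (2 * j) = shapeBallot i j ∧
      signImbalance (2 * i + 1) (2 * j + 1) = -shapeBallot i j) :
    ∀ j ≤ i + 1, signImbalance (2 * i + 2) (2 * j) = shapeBallot i j ∧
      signImbalance (2 * i + 2) (2 * j + 1) = 0 := by
  have heven : (-1 : ℤ) ^ (2 * i + 1 + 1) = 1 := by
    rw [pow_succ, neg_one_pow_two_mul_add_one]; rfl
  intro j
  induction j with
  | zero =>
    intro _
    have := (h1 0 (by omega)).2
    rw [show 2 * i + 2 = 2 * i + 1 + 1 by ring, signImbalance_succ_succ (by omega), heven, mul_zero,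
      signImbalance_zero_right]
    simp_all [shapeBallot]
  | succ j ih =>
    intro hj
    have h2 := (ih (by omega)).2
    have h3 := h1 (j + 1) hj
    have h4 : signImbalance (2 * i + 2) (2 * (j + 1)) = shapeBallot i (j + 1) := by
      rw [show 2 * i + 2 = 2 * i + 1 + 1 by ring, show 2 * (j + 1) = 2 * j + 1 + 1 by ring,
        signImbalance_succ_succ (by omega)]
      rw [show 2 * (j + 1) = 2 * j + 1 + 1 by ring] at h3
      rw [h3.1, h2, mul_zero, add_zero]
    refine ⟨h4, ?_⟩
    rcases Nat.lt_or_ge i (j + 1) with hij | hij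
    · exact signImbalance_eq_zero (by omega)
    · rw [show 2 * i + 2 = 2 * i + 1 + 1 by ring, signImbalance_succ_succ (by omega), h3.2, heven, h4]
      ring

theorem signImbalance_even (i : ℕ) :
    ∀ j ≤ i + 1, signImbalance (2 * i + 2) (2 * j) = shapeBallot i j ∧
      signImbalance (2 * i + 2) (2 * j + 1) = 0 := by
  suffices h1 : ∀ j ≤ i + 1, signImbalance (2 * i + 1) (2 * j) = shapeBallot i j ∧
      signImbalance (2 * i + 1) (2 * j + 1) = -shapeBallot i j from
    signImbalance_even_of_odd i h1
  induction i with
  | zero =>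
    refine signImbalance_odd 0 fun j hj => ?_
    obtain rfl : j = 0 := by omega
    exact ⟨signImbalance_eq_zero (by omega), fun h => absurd h (lt_irrefl _)⟩
  | succ i ih =>
    have he := signImbalance_even_of_odd i ih
    refine signImbalance_odd (i + 1) fun j hj => ⟨(he j hj).2, fun hji => ?_⟩
    rw [shapeBallot_succ_succ, add_sub_cancel_right]
    exact (he (j + 1) hji).1

theorem shapeBallot_eq_ballotNum {n k : ℕ} (hk : k ≤ n) (hn : n ≤ 2 * k + 1) :
    shapeBallot k (n - k) = ballotNum n k := by
  obtain ⟨j, rfl⟩ := Nat.exists_eq_add_of_le hk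
  rw [Nat.add_sub_cancel_left]
  match j with
  | 0 =>
    have : 2 * k + 1 - k = k + 1 := by omega
    rw [shapeBallot, ballotNum, add_zero, this, Nat.choose_self, mul_one,
      Nat.div_self (Nat.succ_pos k)]
    simp
  | j + 1 =>
    have h1 := Nat.add_one_mul_choose_eq (k + j + 1) k
    have h2 := Nat.add_one_mul_choose_eq (k + j + 1) j
    have h3 : (k + j + 1).choose (j + 1) = (k + j + 1).choose k :=
      Nat.choose_symm_of_eq_add (by ring)
    have h4 : (k + j + 1 + 1).choose (j + 1) = (k + j + 1 + 1).choose (k + 1) :=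
      Nat.choose_symm_of_eq_add (by ring)
    rw [h4] at h2
    have h5 : 2 * k + 1 - (k + (j + 1)) = k - j := by omega
    have h6 : j ≤ k := by omega
    have h7 : (k - j) * (k + j + 1 + 1).choose (k + 1) =
        (k + j + 1 + 1) * ((k + j + 1).choose k - (k + j + 1).choose j) := by
      rw [Nat.mul_sub, h1, h2, ← Nat.mul_sub, mul_comm]
      congr 1
      omega
    have h8 : (k + j + 1).choose j ≤ (k + j + 1).choose k := by
      refine Nat.le_of_mul_le_mul_left ?_ (Nat.succ_pos (k + j + 1))
      rw [Nat.succ_eq_add_one, h1, h2]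
      exact Nat.mul_le_mul_left _ (by omega)
    rw [shapeBallot, ballotNum, h5, show k + (j + 1) = k + j + 1 by ring, h7,
      Nat.mul_div_cancel_left _ (Nat.succ_pos _), h3, Nat.cast_sub h8]

theorem signImbalance_even_eq_ballotNum {n k : ℕ} (hk : k ≤ n) :
    signImbalance (2 * k + 2) (2 * (n - k)) = ballotNum n k := by
  rcases Nat.lt_or_ge (2 * k + 1) n with h | h
  · rw [signImbalance_eq_zero (by omega), ballotNum, Nat.sub_eq_zero_of_le h.le]
    simp
  · rw [(signImbalance_even k (n - k) (by omega)).1, shapeBallot_eq_ballotNum hk h]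

theorem sublist_ofFn_iff {α : Type*} {n : ℕ} {f : Fin n → α} {s : List α} :
    s.Sublist (List.ofFn f) ↔ ∃ t : List (Fin n), t.Pairwise (· < ·) ∧ s = t.map f := by
  rw [List.ofFn_eq_map, List.sublist_map_iff]
  refine exists_congr fun t => and_congr_left fun _ => ⟨?_, ?_⟩
  · exact fun h => (List.pairwise_lt_finRange n).sublist h
  · intro h
    refine List.sublist_of_subperm_of_sortedLE (List.subperm_of_subset (h.imp ne_of_lt) ?_)
      ?_ (List.sortedLT_finRange n).sortedLE
    · exact fun x _ => List.mem_finRange x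
    · exact h.sortedLT.sortedLE

theorem listAvoids321_ofFn {n : ℕ} (π : Equiv.Perm (Fin n)) :
    ListAvoids321 (List.ofFn π) ↔ Avoids321 π := by
  refine not_congr ⟨?_, ?_⟩
  · rintro ⟨a, b, c, hs, hcb, hba⟩
    obtain ⟨t, ht, heq⟩ := sublist_ofFn_iff.1 hs
    match t with
    | [] => simp at heq
    | [_] => simp at heq
    | [_, _] => simp at heq
    | [i, j, k] =>
      simp only [List.map_cons, List.map_nil, List.cons.injEq, and_true] at heq
      obtain ⟨rfl, rfl, rfl⟩ := heq
      simp only [List.pairwise_cons, List.mem_cons] at ht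
      exact ⟨i, j, k, ht.1 j (by simp), ht.2.1 k (by simp), hcb, hba⟩
    | _ :: _ :: _ :: _ :: _ => simp at heq
  · rintro ⟨i, j, k, hij, hjk, hkj, hji⟩
    refine ⟨π i, π j, π k, sublist_ofFn_iff.2 ⟨[i, j, k], ?_, rfl⟩, hkj, hji⟩
    simp [hij, hjk, hij.trans hjk]

theorem lis_eq_card {n : ℕ} {π : Equiv.Perm (Fin (n + 1))} {A B : Finset (Fin (n + 1))}
    (h : RowInsert (List.ofFn π) A B) : lis π = A.card := by
  obtain ⟨⟨s, hs, hp, -, hl⟩, hub⟩ := h.longest 0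
  simp only [Fin.zero_le, Finset.filter_true] at hl hub
  refine IsGreatest.csSup_eq ⟨?_, ?_⟩
  · obtain ⟨t, ht, rfl⟩ := sublist_ofFn_iff.1 hs
    refine ⟨t.toFinset, ?_, ?_⟩
    · simp only [List.mem_toFinset]
      rw [List.pairwise_map] at hp
      intro i hi j hj hij
      obtain ⟨a, rfl⟩ := List.get_of_mem hi
      obtain ⟨b, rfl⟩ := List.get_of_mem hj
      refine List.pairwise_iff_get.1 hp a b ?_
      by_contra hab
      rcases (not_lt.1 hab).lt_or_eq with h | rfl
      · exact (List.pairwise_iff_get.1 ht b a h).asymm hij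
      · exact lt_irrefl _ hij
    · rw [List.toFinset_card_of_nodup (ht.imp ne_of_lt), ← hl, List.length_map]
  · rintro k ⟨s, hs, rfl⟩
    have hlt := s.sortedLT_sort.pairwise
    have := hub (s.sort.map π) (sublist_ofFn_iff.2 ⟨_, hlt, rfl⟩) ?_ (by simp)
    · simpa using this
    · rw [List.pairwise_map]
      refine hlt.imp_of_mem fun {a b} ha hb hab => hs a ?_ b ?_ hab
      · simpa using ha
      · simpa using hb

theorem wordSign_ofFn {α : Type*} [LinearOrder α] {n : ℕ} (f : Fin n → α) :
    wordSign (List.ofFn f) = ∏ i, ∏ j ∈ Finset.Ioi i, invSign (f i) (f j) := by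
  induction n with
  | zero => simp [wordSign]
  | succ n ih =>
    rw [List.ofFn_succ, wordSign, ih, Fin.prod_univ_succ, Fin.prod_Ioi_zero, List.map_ofFn,
      List.prod_ofFn]
    simp only [Fin.prod_Ioi_succ, Function.comp_apply]

theorem wordSign_ofFn_perm {n : ℕ} (π : Equiv.Perm (Fin n)) :
    wordSign (List.ofFn π) = (Equiv.Perm.sign π : ℤ) := by
  rw [wordSign_ofFn, π.sign_eq_prod_prod_Ioi]
  push_cast
  refine Finset.prod_congr rfl fun i _ => Finset.prod_congr rfl fun j hj => ?_
  have hne : π i ≠ π j := fun h => (Finset.mem_Ioi.1 hj).ne (π.injective h)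
  rcases hne.lt_or_gt with h | h
  · rw [invSign_of_lt h, if_pos h]; rfl
  · rw [invSign_of_gt h, if_neg h.not_gt]; rfl

theorem exists_perm_ofFn_eq {n : ℕ} {l : List (Fin n)} (hn : l.Nodup)
    (h : l.toFinset = Finset.univ) : ∃ π : Equiv.Perm (Fin n), List.ofFn π = l := by
  have hl : l.length = n := by
    rw [← List.toFinset_card_of_nodup hn, h, Finset.card_univ, Fintype.card_fin]
  have hinj : Function.Injective fun i : Fin n => l.get (i.cast hl.symm) := by
    intro i j hij
    simpa using hn.injective_get hij
  refine ⟨Equiv.ofBijective _ (Finite.injective_iff_bijective.1 hinj), ?_⟩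
  apply List.ext_getElem
  · simp [hl]
  · intro i h1 h2
    simp

theorem eCount_sub_oCount (n k : ℕ) : (eCount n k : ℤ) - oCount n k =
    ∑ π : Equiv.Perm (Fin n) with Avoids321 π ∧ lis π = k, (Equiv.Perm.sign π : ℤ) := by
  have h : ∀ u : ℤˣ, Nat.card {π : Equiv.Perm (Fin n) // Avoids321 π ∧ lis π = k ∧
      Equiv.Perm.sign π = u} = ∑ π : Equiv.Perm (Fin n) with Avoids321 π ∧ lis π = k,
        if Equiv.Perm.sign π = u then 1 else 0 := by
    intro u
    rw [← Finset.card_filter, Finset.filter_filter, Nat.card_eq_fintype_card,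
      Fintype.card_subtype]
    simp only [and_assoc]
  rw [eCount, oCount, h, h]
  push_cast
  rw [← Finset.sum_sub_distrib]
  refine Finset.sum_congr rfl fun π _ => ?_
  rcases Int.units_eq_one_or (Equiv.Perm.sign π) with h | h <;> rw [h] <;> simp

theorem sum_sign_eq (n k j : ℕ) (h : k + j = n + 1) :
    ∑ π : Equiv.Perm (Fin (n + 1)) with Avoids321 π ∧ lis π = k, (Equiv.Perm.sign π : ℤ) =
      (-1) ^ j * signImbalance k j ^ 2 := by
  have himage : (Finset.univ.filter fun π : Equiv.Perm (Fin (n + 1)) =>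
      Avoids321 π ∧ lis π = k).image
        (fun π : Equiv.Perm (Fin (n + 1)) => List.ofFn π) =
      ((Finset.univ : Finset (Fin (n + 1))).powersetCard k).biUnion
        fun A => tableauWords A (Finset.univ \ A) := by
    ext l
    simp only [Finset.mem_image, Finset.mem_filter, Finset.mem_univ, true_and, Finset.mem_biUnion,
      Finset.mem_powersetCard, Finset.subset_univ, mem_tableauWords]
    constructor
    · rintro ⟨π, ⟨hav, hlis⟩, rfl⟩
      obtain ⟨A, B, hR⟩ := exists_rowInsert (List.nodup_ofFn.2 π.injective)
        ((listAvoids321_ofFn π).2 hav)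
      have hB : B = Finset.univ \ A := by
        obtain ⟨h1, -, h3⟩ := hR.disjoint_and_nodup
        have hu : (List.ofFn π).toFinset = Finset.univ := by
          ext x
          simpa only [List.mem_toFinset, List.mem_ofFn, Finset.mem_univ, iff_true] using π.surjective x
        rw [← hu, h3, Finset.union_sdiff_cancel_left h1]
      subst hB
      exact ⟨A, (lis_eq_card hR).symm.trans hlis, hR⟩
    · rintro ⟨A, hA, hR⟩
      obtain ⟨-, h2, h3⟩ := hR.disjoint_and_nodup
      obtain ⟨π, rfl⟩ := exists_perm_ofFn_eq h2 (by
        rw [h3, Finset.union_sdiff_of_subset A.subset_univ])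
      exact ⟨π, ⟨(listAvoids321_ofFn π).1 hR.listAvoids321, (lis_eq_card hR).trans hA⟩, rfl⟩
  have hinj : Function.Injective fun π : Equiv.Perm (Fin (n + 1)) => List.ofFn π :=
    fun π σ hπσ => DFunLike.coe_injective (List.ofFn_injective hπσ)
  calc
    _ = ∑ l ∈ (Finset.univ.filter fun π : Equiv.Perm (Fin (n + 1)) =>
        Avoids321 π ∧ lis π = k).image
        (fun π : Equiv.Perm (Fin (n + 1)) => List.ofFn π), wordSign l := by
      rw [Finset.sum_image hinj.injOn]
      exact Finset.sum_congr rfl fun π _ => (wordSign_ofFn_perm π).symm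
    _ = ∑ A ∈ (Finset.univ : Finset (Fin (n + 1))).powersetCard k,
        ∑ l ∈ tableauWords A (Finset.univ \ A), wordSign l := by
      rw [himage, Finset.sum_biUnion]
      intro A _ A' _ hne
      refine Finset.disjoint_left.2 fun l h1 h2 => hne ?_
      exact ((mem_tableauWords.1 h1).unique (mem_tableauWords.1 h2)).1
    _ = ∑ A ∈ (Finset.univ : Finset (Fin (n + 1))).powersetCard k,
        (if Ballot A (Finset.univ \ A) then tableauSign A (Finset.univ \ A) else 0) *
          ((-1) ^ j * signImbalance k j) := by
      refine Finset.sum_congr rfl fun A hA => ?_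
      obtain ⟨hAu, hAc⟩ := Finset.mem_powersetCard.1 hA
      have hc : (Finset.univ \ A).card = j := by
        rw [Finset.card_sdiff_of_subset hAu, hAc, Finset.card_univ, Fintype.card_fin]
        omega
      rw [sum_wordSign_tableauWords Finset.disjoint_sdiff, hAc, hc, ite_mul, zero_mul]
    _ = _ := by
      rw [← Finset.sum_mul, sum_tableauSign _ (by simpa using h)]
      ring

theorem e_sub_o_even_even (n k : ℕ) :
    (eCount (2 * n + 2) (2 * k + 2) : ℤ) - (oCount (2 * n + 2) (2 * k + 2) : ℤ)
      = (ballotNum n k : ℤ) ^ 2 := by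
  rw [eCount_sub_oCount]
  rcases Nat.lt_or_ge n k with h | h
  · have hb : ballotNum n k = 0 := by
      rw [ballotNum, Nat.choose_eq_zero_of_lt (by omega)]; simp
    rw [hb, Finset.sum_eq_zero]
    · simp
    · intro π hπ
      obtain ⟨-, hav, hlis⟩ := Finset.mem_filter.1 hπ
      obtain ⟨A, B, hR⟩ := exists_rowInsert (List.nodup_ofFn.2 π.injective)
        ((listAvoids321_ofFn π).2 hav)
      have h1 := lis_eq_card hR
      have h2 := Finset.card_le_univ A
      rw [Fintype.card_fin] at h2
      omega
  · rw [sum_sign_eq (2 * n + 1) (2 * k + 2) (2 * (n - k)) (by omega),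
      signImbalance_even_eq_ballotNum h, pow_mul]
    simp
end

section
/- Fix n and k, and let A_{n,k} be the set of ballot sequences b of length n with exactly k entries equal to 1 such that ε(b) > 0. Define φ on A_{n,k} by swapping the entries in positions ε(b) and ε(b)+1 of b. Then φ maps A_{n,k} to itself, φ is an involution (φ(φ(b)) = b for all b ∈ A_{n,k}), and φ reverses the sign: sign(φ(b)) = −sign(b) for all b ∈ A_{n,k}. -/
open scoped Classical

/-- A ballot sequence of length `n`: entries (indexed so that `b i` is the entry in
position `i+1`) are `±1` and all partial sums are nonnegative. -/
def IsBallot {n : ℕ} (b : Fin n → ℤ) : Prop :=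
  (∀ i, b i = 1 ∨ b i = -1) ∧
  ∀ j : Fin n, 0 ≤ ∑ i ∈ Finset.univ.filter (fun i => i ≤ j), b i

/-- The number of entries equal to `1`. -/
def ones {n : ℕ} (b : Fin n → ℤ) : ℕ := (Finset.univ.filter (fun i => b i = 1)).card

/-- `eps b` is the smallest even (1-based) position `d` with `b_d = -b_{d+1}`,
and `0` if no such position exists. -/
noncomputable def eps {n : ℕ} (b : Fin n → ℤ) : ℕ :=
  sInf {d : ℕ | Even d ∧ 1 ≤ d ∧ ∃ h : d < n, b ⟨d - 1, by omega⟩ = -b ⟨d, h⟩}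

/-- The sign of a ballot sequence: `+1` if the sum of the (1-based) positions of the
`-1` entries is even, and `-1` otherwise. -/
noncomputable def bsign {n : ℕ} (b : Fin n → ℤ) : ℤ :=
  if Even (∑ i ∈ Finset.univ.filter (fun i => b i = -1), ((i : ℕ) + 1)) then 1 else -1

/-- The map `φ`: swap the entries in positions `eps b` and `eps b + 1`. -/
noncomputable def phi {n : ℕ} (b : Fin n → ℤ) : Fin n → ℤ :=
  if h : 1 ≤ eps b ∧ eps b < n then
    b ∘ Equiv.swap (⟨eps b - 1, by omega⟩ : Fin n) ⟨eps b, h.2⟩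
  else b

/-- When positive, `eps b` is an even position satisfying its defining property. -/
lemma eps_spec {n : ℕ} {b : Fin n → ℤ} (he : 0 < eps b) :
    Even (eps b) ∧ 1 ≤ eps b ∧ ∃ h : eps b < n, b ⟨eps b - 1, by omega⟩ = -b ⟨eps b, h⟩ :=
  Nat.sInf_mem (Nat.nonempty_of_pos_sInf he)

/-- Swapping two opposite entries in positions `d`, `d + 1` with `d` even preserves `eps`. -/
lemma eps_comp_swap {n : ℕ} {b : Fin n → ℤ} {p q : Fin n} (hpq : (q : ℕ) = p + 1)
    (hq : Even (q : ℕ)) (hbpq : b p = -b q) : eps (b ∘ Equiv.swap p q) = eps b := by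
  unfold eps
  congr 1
  ext d
  simp only [Set.mem_ofPred_eq, Function.comp_apply]
  refine and_congr_right fun hd => and_congr_right fun hd1 => exists_congr fun hn => ?_
  by_cases hdq : d = q
  · have h1 : (⟨d - 1, by omega⟩ : Fin n) = p := Fin.ext (by simp; omega)
    have h2 : (⟨d, hn⟩ : Fin n) = q := Fin.ext hdq
    rw [h1, h2, Equiv.swap_apply_left, Equiv.swap_apply_right]
    omega
  · obtain ⟨x, hx⟩ := hd
    obtain ⟨y, hy⟩ := hq
    rw [Equiv.swap_apply_of_ne_of_ne, Equiv.swap_apply_of_ne_of_ne] <;>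
      · rw [Ne, Fin.ext_iff]
        simp only
        omega

lemma ones_comp_perm {n : ℕ} (b : Fin n → ℤ) (σ : Equiv.Perm (Fin n)) :
    ones (b ∘ σ) = ones b :=
  Finset.card_equiv σ (by simp)

/-- A sum of `±1` entries has the parity of the number of its terms. -/
lemma even_sum_sub_card {ι : Type*} {b : ι → ℤ} (hb : ∀ i, b i = 1 ∨ b i = -1)
    (s : Finset ι) : Even (∑ i ∈ s, b i - s.card) := by
  rw [Finset.card_eq_sum_ones, Nat.cast_sum, ← Finset.sum_sub_distrib]
  refine Finset.even_sum _ fun i _ => ?_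
  rcases hb i with h | h <;> rw [h] <;> decide

/-- Swapping two opposite entries in positions `d`, `d + 1` with `d` even preserves the
ballot property: the partial sum before position `d` is odd, hence positive. -/
lemma IsBallot.comp_swap {n : ℕ} {b : Fin n → ℤ} (hb : IsBallot b) {p q : Fin n}
    (hpq : (q : ℕ) = p + 1) (hq : Even (q : ℕ)) (hbpq : b p = -b q) :
    IsBallot (b ∘ Equiv.swap p q) := by
  refine ⟨fun i => hb.1 _, fun j => ?_⟩
  by_cases hj : j = p
  · subst hj
    have hle : Finset.univ.filter (fun i => i ≤ j) = insert j (Finset.Iio j) := by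
      ext i
      simp [le_iff_eq_or_lt]
    have hle' : Finset.univ.filter (fun i => i ≤ q) = insert q (insert j (Finset.Iio j)) := by
      ext i
      simp only [Finset.mem_filter, Finset.mem_univ, true_and, Finset.mem_insert,
        Finset.mem_Iio, Fin.ext_iff, Fin.le_def, Fin.lt_def]
      omega
    have hqmem : q ∉ insert j (Finset.Iio j) := by
      simp only [Finset.mem_insert, Finset.mem_Iio, Fin.ext_iff, Fin.lt_def]
      omega
    have hsum := hb.2 q
    rw [hle', Finset.sum_insert hqmem, Finset.sum_insert (by simp)] at hsum
    have hpar := even_sum_sub_card hb.1 (Finset.Iio j)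
    rw [Fin.card_Iio] at hpar
    have hrest : ∑ i ∈ Finset.Iio j, (b ∘ Equiv.swap j q) i = ∑ i ∈ Finset.Iio j, b i := by
      refine Finset.sum_congr rfl fun i hi => ?_
      rw [Finset.mem_Iio, Fin.lt_def] at hi
      rw [Function.comp_apply, Equiv.swap_apply_of_ne_of_ne] <;>
        · rw [Ne, Fin.ext_iff]
          omega
    rw [hle, Finset.sum_insert (by simp), hrest, Function.comp_apply, Equiv.swap_apply_left]
    obtain ⟨x, hx⟩ := hq
    obtain ⟨y, hy⟩ := hpar
    rcases hb.1 q with h | h <;> omega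
  · refine (hb.2 j).trans_eq (Finset.sum_equiv (Equiv.swap p q) (fun i => ?_) fun i _ => ?_)
    · rw [Fin.ext_iff] at hj
      simp only [Finset.mem_filter, Finset.mem_univ, true_and, Equiv.swap_apply_def]
      split_ifs with h1 h2 <;> simp only [*, Fin.le_def] <;> omega
    · simp

/-- Swapping two adjacent opposite `±1` entries reverses the sign. -/
lemma bsign_comp_swap {n : ℕ} {b : Fin n → ℤ} {p q : Fin n}
    (hb : b p = 1 ∨ b p = -1) (hpq : (q : ℕ) = p + 1) (hbpq : b p = -b q) :
    bsign (b ∘ Equiv.swap p q) = -bsign b := by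
  have hne : q ≠ p := fun h => by rw [h] at hpq; omega
  have hsplit (f : Fin n → ℕ) :
      ∑ i, f i = f p + (f q + ∑ i ∈ (Finset.univ.erase p).erase q, f i) := by
    rw [Finset.add_sum_erase _ f (by simp [hne]), Finset.add_sum_erase _ f (Finset.mem_univ p)]
  have hrest : ∑ i ∈ (Finset.univ.erase p).erase q,
        (if (b ∘ Equiv.swap p q) i = -1 then (i : ℕ) + 1 else 0) =
      ∑ i ∈ (Finset.univ.erase p).erase q, (if b i = -1 then (i : ℕ) + 1 else 0) := by
    refine Finset.sum_congr rfl fun i hi => ?_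
    simp only [Finset.mem_erase, Finset.mem_univ, and_true] at hi
    rw [Function.comp_apply, Equiv.swap_apply_of_ne_of_ne hi.2 hi.1]
  unfold bsign
  rw [Finset.sum_filter, Finset.sum_filter, hsplit, hsplit, hrest]
  simp only [Function.comp_apply, Equiv.swap_apply_left, Equiv.swap_apply_right, hpq,
    Nat.even_iff]
  have hbq : b q = -b p := by omega
  rcases hb with h | h <;> simp only [hbq, h] <;> norm_num <;> split_ifs <;> omega

lemma phi_eq_comp_swap {n d : ℕ} {b : Fin n → ℤ} (hd : eps b = d) (h1 : 1 ≤ d)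
    (hn : d < n) :
    phi b = b ∘ Equiv.swap (⟨d - 1, by omega⟩ : Fin n) ⟨d, hn⟩ := by
  subst hd
  exact dif_pos ⟨h1, hn⟩

theorem phi_sign_reversing_involution (n k : ℕ) (b : Fin n → ℤ)
    (hb : IsBallot b) (hk : ones b = k) (he : 0 < eps b) :
    (IsBallot (phi b) ∧ ones (phi b) = k ∧ 0 < eps (phi b)) ∧
    phi (phi b) = b ∧ bsign (phi b) = -bsign b := by
  obtain ⟨heven, h1, hn, hopp⟩ := eps_spec he
  have hpq : eps b = (eps b - 1) + 1 := by omega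
  have hphi : phi b = b ∘ Equiv.swap (⟨eps b - 1, by omega⟩ : Fin n) ⟨eps b, hn⟩ :=
    phi_eq_comp_swap rfl h1 hn
  have heps : eps (phi b) = eps b := by
    rw [hphi]
    exact eps_comp_swap hpq heven hopp
  refine ⟨⟨?_, ?_, heps ▸ he⟩, ?_, ?_⟩
  · rw [hphi]
    exact hb.comp_swap hpq heven hopp
  · rw [hphi, ones_comp_perm, hk]
  · rw [phi_eq_comp_swap heps h1 hn, hphi]
    ext i
    simp
  · rw [hphi]
    exact bsign_comp_swap (hb.1 _) hpq hopp
end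

section
/- Let n be odd and let A*_{n,k} be the set of ballot sequences of length n with exactly k entries equal to 1 satisfying ε(b) = 0. If k is odd then |A*_{n,k}| = b((n−1)/2, (k−1)/2), and if k is even then |A*_{n,k}| = 0, where b(n,k) = ((2k−n+1)/(n+1))·C(n+1,k+1) is the ballot number. -/
open scoped Classical

/-- The sum of the first `t` entries of `b`. -/
def prefixSum {n : ℕ} (b : Fin n → ℤ) (t : ℕ) : ℤ := ∑ i : Fin n, if i.val < t then b i else 0

/-- The ballot sequences of length `n` with total sum `s`. -/
def ballotSet (n : ℕ) (s : ℤ) : Set (Fin n → ℤ) := {b | IsBallot b ∧ prefixSum b n = s}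

theorem prefixSum_zero {n : ℕ} (b : Fin n → ℤ) : prefixSum b 0 = 0 := by
  simp [prefixSum]

theorem prefixSum_succ {n : ℕ} (b : Fin n → ℤ) {t : ℕ} (h : t < n) :
    prefixSum b (t + 1) = prefixSum b t + b ⟨t, h⟩ := by
  have key : ∀ i : Fin n, (if i.val < t + 1 then b i else 0)
      = (if i.val < t then b i else 0) + if i = ⟨t, h⟩ then b i else 0 := by
    intro i
    simp only [Fin.ext_iff]
    split_ifs <;> omega
  simp only [prefixSum]
  rw [Finset.sum_congr rfl fun i _ => key i, Finset.sum_add_distrib]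
  simp

theorem isBallot_iff {n : ℕ} (b : Fin n → ℤ) :
    IsBallot b ↔ (∀ i, b i = 1 ∨ b i = -1) ∧ ∀ t ≤ n, 0 ≤ prefixSum b t := by
  have key : ∀ j : Fin n, ∑ i ∈ Finset.univ.filter (fun i => i ≤ j), b i
      = prefixSum b (j.val + 1) := by
    intro j
    rw [Finset.sum_filter]
    exact Finset.sum_congr rfl fun i _ => by simp only [Fin.le_def, Nat.lt_succ_iff]
  simp only [IsBallot, key]
  refine and_congr_right fun _ => ⟨fun h t ht => ?_, fun h j => h _ j.2⟩
  cases t with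
  | zero => exact (prefixSum_zero b).ge
  | succ t => exact h ⟨t, ht⟩

theorem prefixSum_length_eq {n : ℕ} (b : Fin n → ℤ) (hb : ∀ i, b i = 1 ∨ b i = -1) :
    prefixSum b n = 2 * ones b - n := by
  have key : ∀ i : Fin n, (if i.val < n then b i else 0) = 2 * (if b i = 1 then 1 else 0) - 1 := by
    intro i
    rcases hb i with h | h <;> simp [h]
  simp only [prefixSum, ones]
  rw [Finset.sum_congr rfl fun i _ => key i, Finset.sum_sub_distrib, ← Finset.mul_sum]
  simp

theorem prefixSum_snoc {n : ℕ} (c : Fin n → ℤ) (x : ℤ) {t : ℕ} (ht : t ≤ n) :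
    prefixSum (Fin.snoc c x : Fin (n + 1) → ℤ) t = prefixSum c t := by
  simp [prefixSum, Fin.sum_univ_castSucc, ht]

theorem prefixSum_snoc_length {n : ℕ} (c : Fin n → ℤ) (x : ℤ) :
    prefixSum (Fin.snoc c x : Fin (n + 1) → ℤ) (n + 1) = prefixSum c n + x := by
  rw [prefixSum_succ _ n.lt_succ_self, prefixSum_snoc c x le_rfl]
  congr 1
  exact Fin.snoc_last (α := fun _ => ℤ) x c

theorem isBallot_snoc {n : ℕ} (c : Fin n → ℤ) (x : ℤ) :
    IsBallot (Fin.snoc c x : Fin (n + 1) → ℤ) ↔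
      IsBallot c ∧ (x = 1 ∨ x = -1) ∧ 0 ≤ prefixSum c n + x := by
  simp only [isBallot_iff, Fin.forall_fin_succ', Fin.snoc_castSucc, Fin.snoc_last]
  constructor
  · rintro ⟨⟨h, hx⟩, hs⟩
    refine ⟨⟨h, fun t ht => ?_⟩, hx, ?_⟩
    · rw [← prefixSum_snoc c x ht]
      exact hs t (by omega)
    · rw [← prefixSum_snoc_length]
      exact hs _ le_rfl
  · rintro ⟨⟨h, hs⟩, hx, hl⟩
    refine ⟨⟨h, hx⟩, fun t ht => ?_⟩
    rcases Nat.le_succ_iff.mp ht with ht | rfl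
    · rw [prefixSum_snoc c x ht]
      exact hs t ht
    · rwa [prefixSum_snoc_length]

theorem finite_ballotSet (n : ℕ) (s : ℤ) : (ballotSet n s).Finite := by
  refine (Set.Finite.pi' fun _ : Fin n => Set.toFinite ({1, -1} : Set ℤ)).subset ?_
  rintro b ⟨hb, -⟩ i
  exact hb.1 i

theorem ballotSet_eq_empty (n : ℕ) {s : ℤ} (hs : s < 0) : ballotSet n s = ∅ := by
  refine Set.eq_empty_of_forall_notMem ?_
  rintro b ⟨hb, rfl⟩
  exact absurd (((isBallot_iff b).mp hb).2 n le_rfl) (by omega)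

theorem ballotSet_succ (n : ℕ) {s : ℤ} (hs : 0 ≤ s) :
    ballotSet (n + 1) s =
      (fun c => (Fin.snoc c 1 : Fin (n + 1) → ℤ)) '' ballotSet n (s - 1) ∪
      (fun c => (Fin.snoc c (-1) : Fin (n + 1) → ℤ)) '' ballotSet n (s + 1) := by
  ext b
  constructor
  · rintro ⟨hb, hl⟩
    obtain ⟨c, x, rfl⟩ : ∃ (c : Fin n → ℤ) (x : ℤ), b = Fin.snoc c x :=
      ⟨Fin.init b, b (Fin.last n), (Fin.snoc_init_self b).symm⟩
    rw [prefixSum_snoc_length] at hl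
    obtain ⟨hc, rfl | rfl, -⟩ := (isBallot_snoc c x).mp hb
    · exact Or.inl ⟨c, ⟨hc, by omega⟩, rfl⟩
    · exact Or.inr ⟨c, ⟨hc, by omega⟩, rfl⟩
  · rintro (⟨c, ⟨hc, hl⟩, rfl⟩ | ⟨c, ⟨hc, hl⟩, rfl⟩)
    · exact ⟨(isBallot_snoc c _).mpr ⟨hc, by simp, by omega⟩, by
        rw [prefixSum_snoc_length]; omega⟩
    · exact ⟨(isBallot_snoc c _).mpr ⟨hc, by simp, by omega⟩, by
        rw [prefixSum_snoc_length]; omega⟩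

theorem snoc_left_injective (n : ℕ) (x : ℤ) :
    Function.Injective fun c : Fin n → ℤ => (Fin.snoc c x : Fin (n + 1) → ℤ) := by
  intro c d h
  exact (Fin.snoc_injective2 (α := fun _ : Fin (n + 1) => ℤ) h).1

theorem ncard_ballotSet_succ (n : ℕ) {s : ℤ} (hs : 0 ≤ s) :
    (ballotSet (n + 1) s).ncard = (ballotSet n (s - 1)).ncard + (ballotSet n (s + 1)).ncard := by
  rw [ballotSet_succ n hs, Set.ncard_union_eq _ ((finite_ballotSet _ _).image _)
    ((finite_ballotSet _ _).image _), Set.ncard_image_of_injective _ (snoc_left_injective n _),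
    Set.ncard_image_of_injective _ (snoc_left_injective n _)]
  rw [Set.disjoint_left]
  rintro _ ⟨c, -, rfl⟩ ⟨d, -, h⟩
  have := (Fin.snoc_injective2 (α := fun _ : Fin (n + 1) => ℤ) h).2
  omega

theorem ncard_ballotSet_zero : (ballotSet 0 0).ncard = 1 := by
  rw [Set.ncard_eq_one]
  refine ⟨Fin.elim0, Set.eq_singleton_iff_unique_mem.mpr ⟨⟨?_, prefixSum_zero _⟩, fun _ _ =>
    Subsingleton.elim _ _⟩⟩
  exact ⟨fun i => i.elim0, fun i => i.elim0⟩

theorem ballotSet_zero_of_ne {s : ℤ} (hs : s ≠ 0) : ballotSet 0 s = ∅ := by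
  refine Set.eq_empty_of_forall_notMem ?_
  rintro b ⟨-, rfl⟩
  exact hs (prefixSum_zero b)

theorem ncard_ballotSet_add_choose (n j : ℕ) (h : n ≤ 2 * j + 1) :
    (ballotSet n (2 * j - n)).ncard + n.choose (j + 1) = n.choose j := by
  induction n generalizing j with
  | zero =>
    cases j with
    | zero => simpa using ncard_ballotSet_zero
    | succ j => simp [ballotSet_zero_of_ne (s := 2 * ((j : ℤ) + 1)) (by omega)]
  | succ n ih =>
    rcases Nat.lt_or_ge (2 * j) (n + 1) with hlt | hge
    · obtain rfl : n = 2 * j := by omega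
      rw [ballotSet_eq_empty _ (by push_cast; omega), Set.ncard_empty, zero_add,
        Nat.choose_symm_half]
    · obtain ⟨i, rfl⟩ : ∃ i, j = i + 1 := ⟨j - 1, by omega⟩
      rw [ncard_ballotSet_succ n (by omega), Nat.choose_succ_succ n (i + 1),
        Nat.choose_succ_succ n i]
      have h₁ := ih i (by omega)
      have h₂ := ih (i + 1) (by omega)
      rw [show (2 * ((i + 1 : ℕ) : ℤ) - ((n + 1 : ℕ) : ℤ) - 1) = 2 * (i : ℤ) - n by
          push_cast; ring,
        show (2 * ((i + 1 : ℕ) : ℤ) - ((n + 1 : ℕ) : ℤ) + 1) = 2 * ((i + 1 : ℕ) : ℤ) - n by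
          push_cast; ring]
      simp only [Nat.succ_eq_add_one] at *
      omega

theorem ncard_ballotSet (n j : ℕ) : (ballotSet n (2 * j - n)).ncard = ballotNum n j := by
  rcases Nat.lt_or_ge (2 * j) n with hlt | hge
  · rw [ballotSet_eq_empty _ (by omega), ballotNum, show 2 * j + 1 - n = 0 by omega]
    simp
  · have h := ncard_ballotSet_add_choose n j (by omega)
    have h₁ : (n + 1) * n.choose j = (n + 1).choose (j + 1) * (j + 1) :=
      Nat.add_one_mul_choose_eq n j
    have h₂ := Nat.choose_succ_succ n j
    simp only [Nat.succ_eq_add_one] at h₂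
    symm
    refine Nat.div_eq_of_eq_mul_right n.succ_pos ?_
    zify [show n ≤ 2 * j + 1 by omega] at h h₁ h₂ ⊢
    have h₃ : (((ballotSet n (2 * j - n)).ncard : ℕ) : ℤ)
        = 2 * n.choose j - (n + 1).choose (j + 1) := by linarith
    rw [h₃]
    linear_combination (-2) * h₁

/-- The sequence `1, c₁, c₁, c₂, c₂, …`. -/
def double {m : ℕ} (c : Fin m → ℤ) : Fin (2 * m + 1) → ℤ :=
  fun i => if h : i.val = 0 then 1 else c ⟨(i.val - 1) / 2, by omega⟩

theorem double_odd {m : ℕ} (c : Fin m → ℤ) {t : ℕ} (h : t < m) :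
    double c ⟨2 * t + 1, by omega⟩ = c ⟨t, h⟩ := by
  simp [double]

theorem double_even {m : ℕ} (c : Fin m → ℤ) {t : ℕ} (h : t < m) :
    double c ⟨2 * t + 2, by omega⟩ = c ⟨t, h⟩ := by
  simp only [double, Nat.add_eq_zero_iff, OfNat.ofNat_ne_zero, and_false, dite_false]
  congr 2
  omega

theorem prefixSum_double {m : ℕ} (c : Fin m → ℤ) {t : ℕ} (h : t ≤ m) :
    prefixSum (double c) (2 * t + 1) = 1 + 2 * prefixSum c t := by
  induction t with
  | zero =>
    rw [prefixSum_succ _ (by omega), prefixSum_zero, prefixSum_zero]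
    simp [double]
  | succ t ih =>
    rw [show 2 * (t + 1) + 1 = 2 * t + 1 + 1 + 1 by ring, prefixSum_succ _ (by omega),
      prefixSum_succ _ (by omega), ih (by omega), prefixSum_succ c h, double_odd c h,
      double_even c h]
    ring

theorem isBallot_double {m : ℕ} (c : Fin m → ℤ) : IsBallot (double c) ↔ IsBallot c := by
  simp only [isBallot_iff]
  constructor
  · rintro ⟨h, hs⟩
    refine ⟨fun i => ?_, fun t ht => ?_⟩
    · rw [← double_odd c i.2]
      exact h _
    · have := hs (2 * t + 1) (by omega)
      rw [prefixSum_double c ht] at this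
      omega
  · rintro ⟨h, hs⟩
    refine ⟨fun i => ?_, fun t ht => ?_⟩
    · unfold double
      split_ifs
      · exact Or.inl rfl
      · exact h _
    · rcases Nat.even_or_odd' t with ⟨r, rfl | rfl⟩
      · cases r with
        | zero => exact (prefixSum_zero _).ge
        | succ r =>
          rw [show 2 * (r + 1) = 2 * r + 1 + 1 by ring, prefixSum_succ _ (by omega),
            prefixSum_double c (by omega), double_odd c (by omega)]
          have := hs r (by omega)
          have := h ⟨r, by omega⟩
          omega
      · rw [prefixSum_double c (by omega)]
        have := hs r (by omega)
        omega

theorem eps_eq_zero_iff {m : ℕ} (b : Fin (2 * m + 1) → ℤ) :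
    eps b = 0 ↔ ∀ t (h : t < m), b ⟨2 * t + 1, by omega⟩ ≠ -b ⟨2 * t + 2, by omega⟩ := by
  rw [eps, Nat.sInf_eq_zero]
  constructor
  · rintro (⟨-, h, -⟩ | h) t ht heq
    · omega
    · exact Set.notMem_empty (2 * t + 2) (h ▸ ⟨⟨t + 1, by ring⟩, by omega, by omega, heq⟩)
  · refine fun h => Or.inr (Set.eq_empty_of_forall_notMem ?_)
    rintro d ⟨⟨r, rfl⟩, hr, hd, heq⟩
    obtain ⟨t, rfl⟩ : ∃ t, r = t + 1 := ⟨r - 1, by omega⟩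
    refine h t (by omega) ?_
    convert heq using 3 <;> simp <;> omega

theorem double_injective (m : ℕ) : Function.Injective (double (m := m)) := by
  intro c d h
  funext i
  rw [← double_odd c i.2, ← double_odd d i.2, h]

/-- The ballot sequences of odd length with `eps = 0` are the doubled ballot sequences. -/
theorem isBallot_and_eps_eq_zero_iff {m : ℕ} (b : Fin (2 * m + 1) → ℤ) :
    IsBallot b ∧ eps b = 0 ↔ ∃ c : Fin m → ℤ, IsBallot c ∧ double c = b := by
  constructor
  · rintro ⟨hb, he⟩
    rw [eps_eq_zero_iff] at he
    have hd : double (fun i : Fin m => b ⟨2 * i.val + 1, by omega⟩) = b := by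
      funext ⟨i, hi⟩
      rcases Nat.even_or_odd' i with ⟨r, rfl | rfl⟩
      · cases r with
        | zero =>
          have h₀ := ((isBallot_iff b).mp hb).2 1 (by omega)
          rw [prefixSum_succ b (by omega), prefixSum_zero] at h₀
          have h₁ := hb.1 ⟨0, by omega⟩
          simp only [double, mul_zero, dite_true]
          omega
        | succ r =>
          have h₁ := he r (by omega)
          have h₂ := hb.1 ⟨2 * r + 1, by omega⟩
          have h₃ := hb.1 ⟨2 * r + 2, by omega⟩
          refine (double_even _ (by omega)).trans ?_
          change b ⟨2 * r + 1, _⟩ = b ⟨2 * r + 2, _⟩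
          omega
      · exact double_odd _ (by omega)
    exact ⟨_, (isBallot_double _).mp (hd.symm ▸ hb), hd⟩
  · rintro ⟨c, hc, rfl⟩
    refine ⟨(isBallot_double c).mpr hc, (eps_eq_zero_iff _).mpr fun t ht => ?_⟩
    rw [double_odd c ht, double_even c ht]
    have := hc.1 ⟨t, ht⟩
    omega

theorem ones_double {m : ℕ} {c : Fin m → ℤ} (hc : IsBallot c) :
    ones (double c) = 2 * ones c + 1 := by
  have h₁ := prefixSum_length_eq _ ((isBallot_double c).mpr hc).1
  rw [prefixSum_double c le_rfl, prefixSum_length_eq c hc.1] at h₁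
  push_cast at h₁
  omega

theorem card_Astar_odd (n k : ℕ) (hn : Odd n) :
    (Odd k →
      Nat.card {b : Fin n → ℤ // IsBallot b ∧ ones b = k ∧ eps b = 0}
        = ballotNum ((n - 1) / 2) ((k - 1) / 2)) ∧
    (Even k →
      Nat.card {b : Fin n → ℤ // IsBallot b ∧ ones b = k ∧ eps b = 0} = 0) := by
  obtain ⟨m, rfl⟩ := hn
  constructor
  · rintro ⟨j, rfl⟩
    rw [show (2 * m + 1 - 1) / 2 = m by omega, show (2 * j + 1 - 1) / 2 = j by omega,
      ← ncard_ballotSet, ← Set.ncard_image_of_injective _ (double_injective m),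
      ← Nat.card_coe_set_eq]
    refine Nat.card_congr (Equiv.subtypeEquivRight fun b => ?_)
    constructor
    · rintro ⟨hb, hk, he⟩
      obtain ⟨c, hc, rfl⟩ := (isBallot_and_eps_eq_zero_iff b).mp ⟨hb, he⟩
      refine ⟨c, ⟨hc, ?_⟩, rfl⟩
      rw [ones_double hc] at hk
      rw [prefixSum_length_eq c hc.1]
      omega
    · rintro ⟨c, ⟨hc, hl⟩, rfl⟩
      obtain ⟨hb, he⟩ := (isBallot_and_eps_eq_zero_iff _).mpr ⟨c, hc, rfl⟩
      refine ⟨hb, ?_, he⟩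
      rw [prefixSum_length_eq c hc.1] at hl
      rw [ones_double hc]
      omega
  · rintro ⟨j, rfl⟩
    rw [Nat.card_eq_zero]
    refine Or.inl ⟨?_⟩
    rintro ⟨b, hb, hk, he⟩
    obtain ⟨c, hc, rfl⟩ := (isBallot_and_eps_eq_zero_iff b).mp ⟨hb, he⟩
    rw [ones_double hc] at hk
    omega
end

section
/- For all n ≥ 1, the following polynomial identity holds in ℤ[q]: the sum over all 321-avoiding permutations π of {1,…,2n+1} of sign(π)·q^{ldes(π)} equals the sum over all 321-avoiding permutations π of {1,…,n} of q^{2·ldes(π)}. -/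
open scoped Classical
open Polynomial

/-- The last (largest) descent of a permutation, in 1-based positions:
the largest `d` with `π(d) > π(d+1)`, and `0` for the identity (no descent). -/
noncomputable def ldes {n : ℕ} (π : Equiv.Perm (Fin n)) : ℕ :=
  sSup {d : ℕ | 1 ≤ d ∧ ∃ h : d < n, π ⟨d, h⟩ < π ⟨d - 1, by omega⟩}

/-- The last descent is at most `m` exactly when the entries from (zero-based) position `m` on
are increasing. -/
theorem ldes_le_iff {n : ℕ} (π : Equiv.Perm (Fin n)) (m : ℕ) :
    ldes π ≤ m ↔ ∀ i j : Fin n, m ≤ i → i < j → π i < π j := by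
  have bdd : BddAbove {d : ℕ | 1 ≤ d ∧ ∃ h : d < n, π ⟨d, h⟩ < π ⟨d - 1, by omega⟩} :=
    ⟨n, fun d hd => hd.2.1.le⟩
  constructor
  · intro h
    have step : ∀ d (hd : d + 1 < n), m ≤ d → π ⟨d, by omega⟩ < π ⟨d + 1, hd⟩ := by
      intro d hd hm
      by_contra hlt
      have hne : π ⟨d + 1, hd⟩ ≠ π ⟨d, by omega⟩ := by
        simp
      have := le_csSup bdd (show d + 1 ∈ _ from
        ⟨by omega, hd, lt_of_le_of_ne (not_lt.1 hlt) hne⟩)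
      have : d + 1 ≤ ldes π := this
      omega
    rintro ⟨i, hi⟩ ⟨j, hj⟩ hm hij
    simp only [Fin.mk_lt_mk] at hm hij
    induction j, hij using Nat.le_induction with
    | base => exact step i hj hm
    | succ j hij ih => exact (ih (by omega)).trans (step j hj (by omega))
  · intro h
    refine csSup_le' ?_
    rintro d ⟨hd, hn, hlt⟩
    by_contra hm
    exact (h ⟨d - 1, by omega⟩ ⟨d, hn⟩ (by simp; omega) (by simp; omega)).not_gt hlt

/-- Insert a new maximal value at position `p` of a permutation. -/
def insertMax {n : ℕ} (p : Fin (n + 1)) (σ : Equiv.Perm (Fin n)) : Equiv.Perm (Fin (n + 1)) :=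
  finSuccEquivLast.symm.permCongr (Equiv.optionCongr σ) * (Fin.cycleIcc p (Fin.last n))⁻¹

@[simp]
theorem insertMax_self {n : ℕ} (p : Fin (n + 1)) (σ : Equiv.Perm (Fin n)) :
    insertMax p σ p = Fin.last n := by
  have : (Fin.cycleIcc p (Fin.last n))⁻¹ p = Fin.last n := by
    rw [Equiv.Perm.inv_eq_iff_eq, Fin.cycleIcc_of_last (Fin.le_last p)]
  rw [insertMax, Equiv.Perm.mul_apply, this]
  simp [Equiv.permCongr_apply]

@[simp]
theorem insertMax_succAbove {n : ℕ} (p : Fin (n + 1)) (σ : Equiv.Perm (Fin n)) (i : Fin n) :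
    insertMax p σ (p.succAbove i) = (σ i).castSucc := by
  have : (Fin.cycleIcc p (Fin.last n))⁻¹ (p.succAbove i) = i.castSucc := by
    rw [Equiv.Perm.inv_eq_iff_eq, ← Fin.succAbove_last]
    exact (congrFun (Fin.cycleIcc_comp_succAbove p (Fin.last n) (Fin.le_last p)) i).symm
  rw [insertMax, Equiv.Perm.mul_apply, this]
  simp [Equiv.permCongr_apply]

theorem sign_insertMax {n : ℕ} (p : Fin (n + 1)) (σ : Equiv.Perm (Fin n)) :
    Equiv.Perm.sign (insertMax p σ) = (-1) ^ (n - p : ℕ) * Equiv.Perm.sign σ := by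
  rw [insertMax, Equiv.Perm.sign_mul, Equiv.Perm.sign_inv,
    Fin.sign_cycleIcc_of_le (Fin.le_last p), Equiv.Perm.sign_permCongr,
    Equiv.optionCongr_sign, mul_comm, Fin.val_last]

theorem insertMax_bijective (n : ℕ) :
    Function.Bijective (fun x : Equiv.Perm (Fin n) × Fin (n + 1) => insertMax x.2 x.1) := by
  rw [Fintype.bijective_iff_injective_and_card]
  refine ⟨?_, by simp [Fintype.card_perm, Nat.factorial_succ, mul_comm]⟩
  rintro ⟨σ, p⟩ ⟨τ, q⟩ h
  simp only at h
  have hpq : p = q := by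
    apply (insertMax p σ).injective
    rw [insertMax_self, h, insertMax_self]
  subst hpq
  have : σ = τ := by
    ext i
    have := congrArg (fun π => (π (p.succAbove i) : ℕ)) h
    simpa using this
  rw [this]

theorem avoids321_insertMax {n : ℕ} (p : Fin (n + 1)) (σ : Equiv.Perm (Fin n)) :
    Avoids321 (insertMax p σ) ↔ Avoids321 σ ∧ ldes σ ≤ p := by
  rw [ldes_le_iff]
  constructor
  · intro h
    constructor
    · rintro ⟨i, j, k, hij, hjk, h1, h2⟩
      exact h ⟨p.succAbove i, p.succAbove j, p.succAbove k, by simpa, by simpa, by simpa, by simpa⟩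
    · intro i j hi hij
      by_contra hlt
      have hne : σ j ≠ σ i := by simpa using hij.ne'
      refine h ⟨p, p.succAbove i, p.succAbove j, ?_, by simpa, ?_, ?_⟩
      · rw [Fin.lt_succAbove_iff_le_castSucc]
        exact hi
      · simpa using lt_of_le_of_ne (not_lt.1 hlt) hne
      · simp
  · rintro ⟨h, hinc⟩ ⟨i, j, k, hij, hjk, h1, h2⟩
    rcases Fin.eq_self_or_eq_succAbove p j with rfl | ⟨j, rfl⟩
    · rw [insertMax_self] at h2
      exact (Fin.le_last _).not_gt h2
    rcases Fin.eq_self_or_eq_succAbove p k with rfl | ⟨k, rfl⟩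
    · rw [insertMax_self] at h1
      exact (Fin.le_last _).not_gt h1
    rw [insertMax_succAbove, insertMax_succAbove, Fin.castSucc_lt_castSucc_iff] at h1
    rw [Fin.succAbove_lt_succAbove_iff] at hjk
    rcases Fin.eq_self_or_eq_succAbove p i with rfl | ⟨i, rfl⟩
    · rw [Fin.lt_succAbove_iff_le_castSucc] at hij
      exact (hinc j k hij hjk).not_gt h1
    · rw [insertMax_succAbove, insertMax_succAbove, Fin.castSucc_lt_castSucc_iff] at h2
      rw [Fin.succAbove_lt_succAbove_iff] at hij
      exact h ⟨i, j, k, hij, hjk, h1, h2⟩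

theorem ldes_insertMax_last {n : ℕ} (σ : Equiv.Perm (Fin n)) :
    ldes (insertMax (Fin.last n) σ) = ldes σ := by
  refine eq_of_forall_ge_iff fun m => ?_
  rw [ldes_le_iff, ldes_le_iff]
  have key : ∀ i : Fin n, insertMax (Fin.last n) σ i.castSucc = (σ i).castSucc := fun i => by
    rw [← Fin.succAbove_last, insertMax_succAbove]
    simp
  constructor
  · intro h i j hi hij
    simpa [key] using h i.castSucc j.castSucc hi hij
  · intro h i j hi hij
    induction i using Fin.lastCases with
    | last => exact absurd hij (Fin.le_last _).not_gt
    | cast i =>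
      induction j using Fin.lastCases with
      | last => simp [key]
      | cast j => simpa [key] using h i j hi hij

theorem ldes_insertMax_castSucc {n : ℕ} (p : Fin n) (σ : Equiv.Perm (Fin n)) (hσ : ldes σ ≤ p) :
    ldes (insertMax p.castSucc σ) = p + 1 := by
  rw [ldes_le_iff] at hσ
  refine eq_of_forall_ge_iff fun m => ?_
  rw [ldes_le_iff]
  constructor
  · intro h
    by_contra hm
    have := h p.castSucc (p.castSucc.succAbove p) (by simp; omega)
      (by rw [Fin.lt_succAbove_iff_le_castSucc])
    rw [insertMax_self] at this
    exact (Fin.le_last _).not_gt this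
  · intro hm i j hi hij
    have hpi : p.castSucc < i := by
      rw [Fin.lt_def]
      simp
      omega
    obtain ⟨i, rfl⟩ := Fin.exists_succAbove_eq hpi.ne'
    obtain ⟨j, rfl⟩ := Fin.exists_succAbove_eq (hpi.trans hij).ne'
    rw [Fin.lt_succAbove_iff_le_castSucc] at hpi
    rw [Fin.succAbove_lt_succAbove_iff] at hij
    simpa using hσ i j hpi hij

/-- The number of 321-avoiding permutations of size `n` with last descent `k`, each weighted by
a character of its sign. -/
noncomputable def ldesCount (χ : ℤˣ →* ℤ) (n k : ℕ) : ℤ :=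
  ∑ π : Equiv.Perm (Fin n), if Avoids321 π ∧ ldes π = k then χ (Equiv.Perm.sign π) else 0

theorem ldesCount_succ (χ : ℤˣ →* ℤ) (n k : ℕ) :
    ldesCount χ (n + 1) k = ldesCount χ n k + ∑ p : Fin n, ∑ σ : Equiv.Perm (Fin n),
      if (Avoids321 σ ∧ ldes σ ≤ p) ∧ (p : ℕ) + 1 = k then
        χ (-1) ^ (n - p : ℕ) * χ (Equiv.Perm.sign σ) else 0 := by
  rw [ldesCount, ← (insertMax_bijective n).sum_comp, Fintype.sum_prod_type_right,
    Fin.sum_univ_castSucc, add_comm, ldesCount]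
  congr 1
  · refine Finset.sum_congr rfl fun σ _ => ?_
    have : ldes σ ≤ (Fin.last n : ℕ) := by
      rw [ldes_le_iff]
      intro i j hi
      simp at hi
      omega
    simp only [avoids321_insertMax, ldes_insertMax_last, this, and_true, sign_insertMax]
    simp
  · refine Finset.sum_congr rfl fun p _ => Finset.sum_congr rfl fun σ _ => ?_
    simp only [avoids321_insertMax, sign_insertMax, Fin.val_castSucc, map_mul, map_pow]
    by_cases h : ldes σ ≤ p
    · rw [ldes_insertMax_castSucc p σ h]
    · simp [h]

theorem ldesCount_succ_of_not_mem (χ : ℤˣ →* ℤ) {n k : ℕ} (h : k = 0 ∨ n < k) :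
    ldesCount χ (n + 1) k = ldesCount χ n k := by
  rw [ldesCount_succ, add_eq_left]
  refine Finset.sum_eq_zero fun p _ => Finset.sum_eq_zero fun σ _ => if_neg ?_
  have := p.2
  omega

theorem ldesCount_succ_succ (χ : ℤˣ →* ℤ) {n j : ℕ} (h : j < n) :
    ldesCount χ (n + 1) (j + 1) = ldesCount χ n (j + 1) +
      χ (-1) ^ (n - j) * ∑ d ∈ Finset.range (j + 1), ldesCount χ n d := by
  rw [ldesCount_succ, Finset.sum_eq_single (⟨j, h⟩ : Fin n)]
  · simp only [ldesCount]
    rw [Finset.sum_comm, Finset.mul_sum]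
    congr 1
    refine Finset.sum_congr rfl fun σ _ => ?_
    by_cases hσ : Avoids321 σ
    · simp [hσ]
    · simp [hσ]
  · intro p _ hp
    refine Finset.sum_eq_zero fun σ _ => if_neg ?_
    rintro ⟨-, hpj⟩
    exact hp (Fin.ext (by simpa using hpj))
  · simp

theorem ldesCount_eq_zero (χ : ℤˣ →* ℤ) {n k : ℕ} (hn : n ≤ k) (hk : 0 < k) :
    ldesCount χ n k = 0 := by
  refine Finset.sum_eq_zero fun σ _ => if_neg ?_
  rintro ⟨-, h⟩
  have : ldes σ ≤ k - 1 := by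
    rw [ldes_le_iff]
    intro i j hi hij
    omega
  omega

theorem ldesCount_zero_zero (χ : ℤˣ →* ℤ) : ldesCount χ 0 0 = 1 := by
  have h : ∀ σ : Equiv.Perm (Fin 0), Avoids321 σ ∧ ldes σ = 0 := fun σ =>
    ⟨fun ⟨i, _⟩ => i.elim0, Nat.le_zero.1 ((ldes_le_iff σ 0).2 fun i => i.elim0)⟩
  simp [ldesCount, h]

/-- The unsigned counts are the prefix sums of the previous ones. -/
theorem ldesCount_one_succ {n k : ℕ} (h : k ≤ n) :
    ldesCount 1 (n + 1) k = ∑ d ∈ Finset.range (k + 1), ldesCount 1 n d := by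
  cases k with
  | zero => simp [ldesCount_succ_of_not_mem]
  | succ j =>
    rw [ldesCount_succ_succ 1 (by omega), Finset.sum_range_succ _ (j + 1)]
    simp [add_comm]

theorem sum_range_of_even_of_odd_zero {f g : ℕ → ℤ} (h0 : ∀ k, f (2 * k) = g k)
    (h1 : ∀ k, f (2 * k + 1) = 0) (j : ℕ) :
    ∑ d ∈ Finset.range (2 * j), f d = ∑ d ∈ Finset.range j, g d := by
  induction j with
  | zero => simp
  | succ j ih =>
    rw [show 2 * (j + 1) = 2 * j + 1 + 1 by ring, Finset.sum_range_succ, Finset.sum_range_succ, ih,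
      h0, h1, add_zero, Finset.sum_range_succ]

theorem sum_range_of_even_add_odd {f : ℕ → ℤ} {m : ℕ}
    (h : ∀ k < m, f (2 * k) + f (2 * k + 1) = 0) {j : ℕ} (hj : j ≤ m) :
    ∑ d ∈ Finset.range (2 * j), f d = 0 := by
  induction j with
  | zero => simp
  | succ j ih =>
    rw [show 2 * (j + 1) = 2 * j + 1 + 1 by ring, Finset.sum_range_succ, Finset.sum_range_succ,
      ih (by omega), add_assoc, h j (by omega), add_zero]

theorem ldesCount_sign_even {n : ℕ}
    (h : ∀ k, ldesCount (Units.coeHom ℤ) (2 * n + 1) (2 * k) = ldesCount 1 n k ∧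
      ldesCount (Units.coeHom ℤ) (2 * n + 1) (2 * k + 1) = 0) {k : ℕ} (hk : k ≤ n) :
    ldesCount (Units.coeHom ℤ) (2 * n + 2) (2 * k) = ldesCount 1 (n + 1) k ∧
      ldesCount (Units.coeHom ℤ) (2 * n + 2) (2 * k + 1) = -ldesCount 1 (n + 1) k := by
  have hsum := sum_range_of_even_of_odd_zero (fun k => (h k).1) (fun k => (h k).2)
  constructor
  · rw [ldesCount_one_succ hk]
    cases k with
    | zero =>
      have := (h 0).1
      rw [mul_zero] at this
      rw [mul_zero, ldesCount_succ_of_not_mem _ (Or.inl rfl), this]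
      simp
    | succ j =>
      rw [show 2 * (j + 1) = (2 * j + 1) + 1 by ring, ldesCount_succ_succ _ (by omega),
        show 2 * j + 1 + 1 = 2 * (j + 1) by ring, hsum, (h (j + 1)).1,
        Finset.sum_range_succ _ (j + 1), show 2 * n + 1 - (2 * j + 1) = 2 * (n - j) by omega]
      simp [add_comm]
  · rw [ldesCount_one_succ hk, ldesCount_succ_succ _ (by omega), (h k).2,
      Finset.sum_range_succ _ (2 * k), hsum, (h k).1, Finset.sum_range_succ _ k,
      show 2 * n + 1 - 2 * k = 2 * (n - k) + 1 by omega]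
    simp [pow_succ]

theorem ldesCount_sign_odd (n k : ℕ) :
    ldesCount (Units.coeHom ℤ) (2 * n + 1) (2 * k) = ldesCount 1 n k ∧
      ldesCount (Units.coeHom ℤ) (2 * n + 1) (2 * k + 1) = 0 := by
  induction n generalizing k with
  | zero =>
    refine ⟨?_, ldesCount_eq_zero _ (by omega) (by omega)⟩
    rcases Nat.eq_zero_or_pos k with rfl | hk
    · rw [mul_zero, ldesCount_succ_of_not_mem _ (Or.inl rfl), ldesCount_zero_zero, ldesCount_zero_zero]
    · rw [ldesCount_eq_zero _ (by omega) (by omega), ldesCount_eq_zero _ (by omega) hk]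
  | succ n ih =>
    have heven := fun {k : ℕ} (hk : k ≤ n) => ldesCount_sign_even ih hk
    have hsum : ∀ {j : ℕ}, j ≤ n + 1 →
        ∑ d ∈ Finset.range (2 * j), ldesCount (Units.coeHom ℤ) (2 * n + 2) d = 0 :=
      sum_range_of_even_add_odd fun k hk => by
        rw [(heven (by omega)).1, (heven (by omega)).2, add_neg_cancel]
    rcases Nat.lt_or_ge n k with hk | hk
    · rw [ldesCount_eq_zero 1 hk (by omega)]
      refine ⟨?_, ldesCount_eq_zero _ (by omega) (by omega)⟩
      rcases Nat.lt_or_ge (n + 1) k with hk' | hk'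
      · exact ldesCount_eq_zero _ (by omega) (by omega)
      · obtain rfl : k = n + 1 := by omega
        rw [show 2 * (n + 1) = (2 * n + 1) + 1 by ring, ldesCount_succ_succ _ (by omega),
          ldesCount_eq_zero _ (by omega) (by omega),
          show 2 * n + 1 + 1 = 2 * (n + 1) by ring]
        have := hsum (le_refl (n + 1))
        rw [show 2 * n + 2 = 2 * (n + 1) by ring] at this
        rw [this, mul_zero, add_zero]
    · constructor
      · rw [← (heven hk).1, show 2 * (n + 1) + 1 = (2 * n + 2) + 1 by ring]
        cases k with
        | zero => exact ldesCount_succ_of_not_mem _ (Or.inl rfl)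
        | succ j =>
          rw [show 2 * (j + 1) = (2 * j + 1) + 1 by ring, ldesCount_succ_succ _ (by omega),
            show 2 * j + 1 + 1 = 2 * (j + 1) by ring, hsum (by omega), mul_zero, add_zero]
      · rw [show 2 * (n + 1) + 1 = (2 * n + 2) + 1 by ring, ldesCount_succ_succ _ (by omega),
          (heven hk).2, Finset.sum_range_succ _ (2 * k), hsum (by omega), (heven hk).1,
          show 2 * n + 2 - 2 * k = 2 * (n + 1 - k) by omega]
        simp

theorem sign_balance_ldes_odd (n : ℕ) (hn : 1 ≤ n) :
    ∑ π ∈ Finset.univ.filter (fun π : Equiv.Perm (Fin (2 * n + 1)) => Avoids321 π),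
        C ((Equiv.Perm.sign π : ℤ)) * X ^ ldes π
      =
    ∑ π ∈ Finset.univ.filter (fun π : Equiv.Perm (Fin n) => Avoids321 π),
        (X : Polynomial ℤ) ^ (2 * ldes π) := by
  ext m
  have hl : (∑ π ∈ Finset.univ.filter (fun π : Equiv.Perm (Fin (2 * n + 1)) => Avoids321 π),
      C ((Equiv.Perm.sign π : ℤ)) * X ^ ldes π).coeff m =
      ldesCount (Units.coeHom ℤ) (2 * n + 1) m := by
    rw [finsetSum_coeff, Finset.sum_filter, ldesCount]
    refine Finset.sum_congr rfl fun π _ => ?_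
    by_cases h : Avoids321 π <;> simp [h, coeff_X_pow, eq_comm]
  rw [hl, finsetSum_coeff, Finset.sum_filter]
  obtain ⟨k, rfl | rfl⟩ := Nat.even_or_odd' m
  · rw [(ldesCount_sign_odd n k).1, ldesCount]
    refine Finset.sum_congr rfl fun π _ => ?_
    by_cases h : Avoids321 π <;> simp [h, coeff_X_pow, eq_comm]
  · rw [(ldesCount_sign_odd n k).2]
    refine (Finset.sum_eq_zero fun π _ => ?_).symm
    have : 2 * k + 1 ≠ 2 * ldes π := by omega
    split_ifs <;> simp [coeff_X_pow, this]
end
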